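/- arXiv:1401.6373 — 5 statements merged into one kernel-verified Lean document; each statement's English description precedes it below -/
import Mathlib

section
/- Let a ∈ (0,1) and let k ≥ 2 be an integer. There exists a real number Y such that, as t ↓ 0, h_{a,1-a}(t) − ( −(1/2) log t + Y + Σ_{n=1}^{k} c_n(a, 1−a) t^{n/2} ) = O(t^{(k+1)/2}). -/
open MeasureTheory

/-- The heat content of `[0,1]` in `ℝ` with initial temperature `x^{-a}` and
specific heat `y^{-b}`, for complex `a`, `b`. -/
noncomputable def heatContentI (a b : ℂ) (t : ℝ) : ℂ :=
  (↑(Real.sqrt (4 * Real.pi * t)) : ℂ)⁻¹ *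
    ∫ x in (0:ℝ)..1, ∫ y in (0:ℝ)..1,
      (↑(Real.exp (-(x - y) ^ 2 / (4 * t))) : ℂ) * (x : ℂ) ^ (-a) * (y : ℂ) ^ (-b)

/-- The ascending factorial `θ_n(a) = a(a+1)⋯(a+n-1)`, with `θ_0(a) = 1`. -/
noncomputable def thetaAsc (a : ℂ) (n : ℕ) : ℂ :=
  ∏ i ∈ Finset.range n, (a + i)

/-- The coefficient `c_n(a,b)` of `t^{n/2}` in the heat content expansion. -/
noncomputable def cnCoeff (a b : ℂ) (n : ℕ) : ℂ :=
  (thetaAsc a n + thetaAsc b n) * (2 : ℂ) ^ ((n : ℤ) - 1) *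
      Complex.Gamma ((1 + (n : ℂ)) / 2) /
    ((↑(Real.sqrt Real.pi) : ℂ) * (1 - a - b - (n : ℂ)) * (n.factorial : ℂ))

/-- Taylor coefficient of `(1 - v) ^ (-β)` at `v = 0`. -/
noncomputable def risingCoeff (β : ℝ) (n : ℕ) : ℝ :=
  (∏ i ∈ Finset.range n, (β + i)) / n.factorial

lemma choose_eq_risingCoeff (β : ℝ) (n : ℕ) : Ring.choose (β + n - 1) n = risingCoeff β n := by
  have h1 : Ring.choose (β + n - 1) n = Ring.multichoose β n := by
    rw [Ring.choose]; congr 1; ring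
  have h2 := Ring.factorial_nsmul_multichoose_eq_ascPochhammer β n
  have h3 (m : ℕ) : (ascPochhammer ℕ m).smeval β = ∏ i ∈ Finset.range m, (β + i) := by
    rw [Polynomial.ascPochhammer_smeval_eq_eval]
    induction m with
    | zero => simp
    | succ m ih => rw [ascPochhammer_succ_eval, Finset.prod_range_succ, ih]
  rw [h1, risingCoeff, ← h3, ← h2, nsmul_eq_mul]
  field_simp

lemma risingCoeff_succ (β : ℝ) (n : ℕ) :
    risingCoeff β (n + 1) = risingCoeff β n * ((β + n) / (n + 1)) := by
  simp only [risingCoeff, Finset.prod_range_succ, Nat.factorial_succ]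
  push_cast
  field_simp

lemma risingCoeff_nonneg {β : ℝ} (h0 : 0 < β) (n : ℕ) : 0 ≤ risingCoeff β n := by
  unfold risingCoeff
  positivity

lemma risingCoeff_antitone {β : ℝ} (h0 : 0 < β) (h1 : β < 1) : Antitone (risingCoeff β) := by
  refine antitone_nat_of_succ_le fun n ↦ ?_
  rw [risingCoeff_succ]
  refine mul_le_of_le_one_right (risingCoeff_nonneg h0 n) ?_
  rw [div_le_one (by positivity)]
  linarith

lemma hasSum_risingCoeff (β : ℝ) {v : ℝ} (hv : v ∈ Set.Ioo 0 1) :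
    HasSum (fun n ↦ risingCoeff β n * v ^ n) ((1 - v) ^ (-β)) := by
  have h := (Real.one_div_one_sub_rpow_hasFPowerSeriesOnBall_zero β).hasSum (y := v) (by
    simpa [Metric.mem_eball, abs_of_pos hv.1, enorm_eq_nnnorm, ← NNReal.coe_lt_coe] using hv.2)
  rw [zero_add, one_div, ← Real.rpow_neg (by linarith [hv.2])] at h
  simpa [FormalMultilinearSeries.ofScalars, choose_eq_risingCoeff] using h

lemma abs_rpow_sub_taylor_le {β : ℝ} (h0 : 0 < β) (h1 : β < 1) (N : ℕ) {v : ℝ}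
    (hv : v ∈ Set.Ioo 0 1) :
    |(1 - v) ^ (-β) - ∑ n ∈ Finset.range N, risingCoeff β n * v ^ n| ≤ v ^ N * (1 - v) ^ (-β) := by
  have h := hasSum_risingCoeff β hv
  have h2 := (hasSum_nat_add_iff' N).mpr h
  have hn (n : ℕ) : 0 ≤ risingCoeff β n * v ^ n :=
    mul_nonneg (risingCoeff_nonneg h0 n) (pow_nonneg hv.1.le n)
  rw [abs_of_nonneg (h2.nonneg fun n ↦ hn (n + N))]
  refine hasSum_le (fun n ↦ ?_) h2 (h.mul_left (v ^ N))
  calc risingCoeff β (n + N) * v ^ (n + N) ≤ risingCoeff β n * v ^ (n + N) :=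
        mul_le_mul_of_nonneg_right (risingCoeff_antitone h0 h1 (Nat.le_add_right n N))
          (pow_nonneg hv.1.le _)
    _ = _ := by ring

/-- The Laplace-type integral `∫₀¹ (1 - v) ^ (-β) exp (-(s v)²) dv`. -/
noncomputable def gaussLaplace (β s : ℝ) : ℝ :=
  ∫ v in Set.Ioo (0 : ℝ) 1, (1 - v) ^ (-β) * Real.exp (-(s * v) ^ 2)

lemma integrableOn_one_sub_rpow {β : ℝ} (h1 : β < 1) :
    IntegrableOn (fun v : ℝ ↦ (1 - v) ^ (-β)) (Set.Ioo 0 1) := by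
  have h := (intervalIntegral.intervalIntegrable_rpow' (a := 0) (b := 1) (r := -β)
    (by linarith)).comp_sub_left 1
  simp only [sub_zero, sub_self] at h
  rw [intervalIntegrable_iff, Set.uIoc_comm, Set.uIoc_of_le zero_le_one] at h
  exact h.mono_set Set.Ioo_subset_Ioc_self

lemma continuous_gaussLaplace {β : ℝ} (h1 : β < 1) : Continuous (gaussLaplace β) := by
  refine continuous_of_dominated (bound := fun v ↦ |(1 - v) ^ (-β)|) (fun s ↦ ?_) (fun s ↦ ?_)
    (integrableOn_one_sub_rpow h1).abs ?_
  · exact (integrableOn_one_sub_rpow h1).aestronglyMeasurable.mul (by fun_prop)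
  · refine Filter.Eventually.of_forall fun v ↦ ?_
    rw [norm_mul, Real.norm_eq_abs, Real.norm_eq_abs, Real.abs_exp]
    refine mul_le_of_le_one_right (abs_nonneg _) (Real.exp_le_one_iff.mpr ?_)
    nlinarith [sq_nonneg (s * v)]
  · exact Filter.Eventually.of_forall fun v ↦ by fun_prop

/-- The moment `∫₀^∞ v ^ n exp (-v²) dv`. -/
noncomputable def gaussMoment (n : ℕ) : ℝ := Real.Gamma ((n + 1) / 2) / 2

lemma gaussMoment_nonneg (n : ℕ) : 0 ≤ gaussMoment n := by
  unfold gaussMoment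
  have := Real.Gamma_pos_of_pos (s := ((n : ℝ) + 1) / 2) (by positivity)
  positivity

lemma integrableOn_pow_mul_exp {s : ℝ} (hs : 0 < s) (n : ℕ) :
    IntegrableOn (fun v : ℝ ↦ v ^ n * Real.exp (-(s * v) ^ 2)) (Set.Ioi 0) := by
  have h := integrableOn_rpow_mul_exp_neg_mul_sq (b := s ^ 2) (by positivity) (s := n)
    (by linarith [Nat.cast_nonneg (α := ℝ) n])
  simpa only [Real.rpow_natCast, neg_mul, mul_pow] using h

lemma integral_pow_mul_exp {s : ℝ} (hs : 0 < s) (n : ℕ) :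
    ∫ v in Set.Ioi (0 : ℝ), v ^ n * Real.exp (-(s * v) ^ 2) = gaussMoment n * (s ^ (n + 1))⁻¹ := by
  have h := integral_rpow_mul_exp_neg_mul_rpow (p := 2) (q := n) (b := s ^ 2) (by norm_num)
    (by linarith [Nat.cast_nonneg (α := ℝ) n]) (by positivity)
  have h2 : (s ^ 2) ^ (-((n : ℝ) + 1) / 2) = (s ^ (n + 1))⁻¹ := by
    rw [← Real.rpow_natCast s 2, ← Real.rpow_mul hs.le, ← Real.rpow_natCast s (n + 1),
      ← Real.rpow_neg hs.le]
    congr 1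
    push_cast
    ring
  simp only [Real.rpow_natCast, neg_mul, Real.rpow_ofNat, ← mul_pow] at h
  rw [h, gaussMoment, h2]
  ring

lemma abs_integral_Ioo_pow_mul_exp_sub_le {s : ℝ} (hs : 0 < s) {n N : ℕ} (hn : n ≤ N) :
    |(∫ v in Set.Ioo (0 : ℝ) 1, v ^ n * Real.exp (-(s * v) ^ 2)) - gaussMoment n * (s ^ (n + 1))⁻¹|
      ≤ gaussMoment N * (s ^ (N + 1))⁻¹ := by
  have hsub : Set.Ici (1 : ℝ) ⊆ Set.Ioi 0 := fun v (hv : 1 ≤ v) ↦ lt_of_lt_of_le one_pos hv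
  have hi := integrableOn_pow_mul_exp hs n
  have hsplit : Set.Ioi (0 : ℝ) = Set.Ioo 0 1 ∪ Set.Ici 1 := (Set.Ioo_union_Ici_eq_Ioi one_pos).symm
  have hdisj : Disjoint (Set.Ioo (0 : ℝ) 1) (Set.Ici 1) :=
    Set.disjoint_left.mpr fun v h1 h2 ↦ absurd h1.2 (not_lt.mpr h2)
  have h := setIntegral_union hdisj measurableSet_Ici (hi.mono_set Set.Ioo_subset_Ioi_self)
    (hi.mono_set hsub)
  rw [← hsplit, integral_pow_mul_exp hs] at h
  rw [h, sub_add_cancel_left, abs_neg, abs_of_nonneg, ← integral_pow_mul_exp hs]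
  · calc ∫ v in Set.Ici (1 : ℝ), v ^ n * Real.exp (-(s * v) ^ 2)
        ≤ ∫ v in Set.Ici (1 : ℝ), v ^ N * Real.exp (-(s * v) ^ 2) := by
          refine setIntegral_mono_on (hi.mono_set hsub)
            ((integrableOn_pow_mul_exp hs N).mono_set hsub) measurableSet_Ici fun v hv ↦ ?_
          exact mul_le_mul_of_nonneg_right (pow_le_pow_right₀ hv hn) (Real.exp_pos _).le
      _ ≤ _ := by
          refine setIntegral_mono_set (integrableOn_pow_mul_exp hs N) ?_ hsub.eventuallyLE
          filter_upwards [ae_restrict_mem measurableSet_Ioi] with v (hv : 0 < v)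
          positivity
  · refine setIntegral_nonneg measurableSet_Ici fun v hv ↦ ?_
    have : 0 < v := hsub hv
    positivity

lemma exists_pow_mul_exp_neg_sq_le (N : ℕ) :
    ∃ C : ℝ, 0 ≤ C ∧ ∀ s v : ℝ, 0 < s → 0 < v →
      v ^ N * Real.exp (-(s * v) ^ 2) ≤ C * (s ^ N)⁻¹ := by
  refine ⟨N.factorial * Real.exp 1, by positivity, fun s v hs hv ↦ ?_⟩
  have h1 : (s * v) ^ N ≤ N.factorial * Real.exp (s * v) := by
    have := Real.pow_div_factorial_le_exp (s * v) (by positivity) N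
    rwa [div_le_iff₀' (by positivity)] at this
  have h2 : Real.exp (s * v) * Real.exp (-(s * v) ^ 2) ≤ Real.exp 1 := by
    rw [← Real.exp_add]
    exact Real.exp_le_exp.mpr (by nlinarith [sq_nonneg (s * v - 1 / 2)])
  rw [le_mul_inv_iff₀ (by positivity)]
  calc v ^ N * Real.exp (-(s * v) ^ 2) * s ^ N = (s * v) ^ N * Real.exp (-(s * v) ^ 2) := by ring
    _ ≤ N.factorial * Real.exp (s * v) * Real.exp (-(s * v) ^ 2) := by gcongr
    _ = N.factorial * (Real.exp (s * v) * Real.exp (-(s * v) ^ 2)) := by ring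
    _ ≤ _ := by gcongr

lemma exists_gaussLaplace_expansion_aux {β : ℝ} (h0 : 0 < β) (h1 : β < 1) (N : ℕ) :
    ∃ C : ℝ, ∀ s : ℝ, 1 ≤ s →
      |gaussLaplace β s
          - ∑ n ∈ Finset.range N, risingCoeff β n * (gaussMoment n * (s ^ (n + 1))⁻¹)|
        ≤ C * (s ^ N)⁻¹ := by
  obtain ⟨C, hC, hCb⟩ := exists_pow_mul_exp_neg_sq_le N
  refine ⟨C * (∫ v in Set.Ioo (0 : ℝ) 1, (1 - v) ^ (-β))
    + ∑ n ∈ Finset.range N, risingCoeff β n * gaussMoment N, fun s hs1 ↦ ?_⟩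
  have hs : 0 < s := by linarith
  have hg := integrableOn_one_sub_rpow h1
  have hpow (n : ℕ) : IntegrableOn (fun v : ℝ ↦ risingCoeff β n *
      (v ^ n * Real.exp (-(s * v) ^ 2))) (Set.Ioo 0 1) :=
    ((integrableOn_pow_mul_exp hs n).mono_set Set.Ioo_subset_Ioi_self).const_mul _
  have hge : IntegrableOn (fun v : ℝ ↦ (1 - v) ^ (-β) * Real.exp (-(s * v) ^ 2))
      (Set.Ioo 0 1) := by
    refine hg.mul_bdd (c := 1) (by fun_prop) (Filter.Eventually.of_forall fun v ↦ ?_)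
    rw [Real.norm_eq_abs, Real.abs_exp]
    exact Real.exp_le_one_iff.mpr (by nlinarith [sq_nonneg (s * v)])
  have hrem : |gaussLaplace β s - ∑ n ∈ Finset.range N, risingCoeff β n *
      ∫ v in Set.Ioo (0 : ℝ) 1, v ^ n * Real.exp (-(s * v) ^ 2)|
      ≤ C * (∫ v in Set.Ioo (0 : ℝ) 1, (1 - v) ^ (-β)) * (s ^ N)⁻¹ := by
    simp_rw [gaussLaplace, ← integral_const_mul]
    rw [← integral_finsetSum _ fun n _ ↦ hpow n,
      ← integral_sub hge (integrable_finsetSum _ fun n _ ↦ hpow n), ← integral_mul_const,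
      ← Real.norm_eq_abs]
    refine norm_integral_le_of_norm_le ((hg.const_mul C).mul_const _) ?_
    filter_upwards [ae_restrict_mem measurableSet_Ioo] with v hv
    have hb := abs_rpow_sub_taylor_le h0 h1 N hv
    have hpos : 0 ≤ (1 - v) ^ (-β) := Real.rpow_nonneg (by linarith [hv.2]) _
    have : (1 - v) ^ (-β) * Real.exp (-(s * v) ^ 2)
        - ∑ n ∈ Finset.range N, risingCoeff β n * (v ^ n * Real.exp (-(s * v) ^ 2))
        = ((1 - v) ^ (-β) - ∑ n ∈ Finset.range N, risingCoeff β n * v ^ n)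
          * Real.exp (-(s * v) ^ 2) := by
      simp_rw [sub_mul, Finset.sum_mul, mul_assoc]
    rw [this, norm_mul, Real.norm_eq_abs, Real.norm_eq_abs, Real.abs_exp]
    calc _ ≤ v ^ N * (1 - v) ^ (-β) * Real.exp (-(s * v) ^ 2) := by gcongr
      _ = (v ^ N * Real.exp (-(s * v) ^ 2)) * (1 - v) ^ (-β) := by ring
      _ ≤ C * (s ^ N)⁻¹ * (1 - v) ^ (-β) := by
        exact mul_le_mul_of_nonneg_right (hCb s v hs hv.1) hpos
      _ = _ := by ring
  have hpoly : |(∑ n ∈ Finset.range N, risingCoeff β n *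
      ∫ v in Set.Ioo (0 : ℝ) 1, v ^ n * Real.exp (-(s * v) ^ 2))
      - ∑ n ∈ Finset.range N, risingCoeff β n * (gaussMoment n * (s ^ (n + 1))⁻¹)|
      ≤ (∑ n ∈ Finset.range N, risingCoeff β n * gaussMoment N) * (s ^ N)⁻¹ := by
    rw [← Finset.sum_sub_distrib, Finset.sum_mul]
    refine (Finset.abs_sum_le_sum_abs _ _).trans (Finset.sum_le_sum fun n hn ↦ ?_)
    rw [← mul_sub, abs_mul, abs_of_nonneg (risingCoeff_nonneg h0 n), mul_assoc]
    refine mul_le_mul_of_nonneg_left ?_ (risingCoeff_nonneg h0 n)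
    refine (abs_integral_Ioo_pow_mul_exp_sub_le hs (Finset.mem_range.mp hn).le).trans ?_
    exact mul_le_mul_of_nonneg_left (inv_anti₀ (by positivity)
      (pow_le_pow_right₀ hs1 (Nat.le_succ N))) (gaussMoment_nonneg N)
  rw [add_mul]
  exact (abs_sub_le _ _ _).trans (add_le_add hrem hpoly)

/-- Watson's lemma for `gaussLaplace`. -/
lemma exists_gaussLaplace_expansion {β : ℝ} (h0 : 0 < β) (h1 : β < 1) (k : ℕ) :
    ∃ C : ℝ, ∀ s : ℝ, 1 ≤ s →
      |gaussLaplace β s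
          - ∑ n ∈ Finset.range (k + 1), risingCoeff β n * gaussMoment n * (s ^ (n + 1))⁻¹|
        ≤ C * (s ^ (k + 2))⁻¹ := by
  obtain ⟨C, hC⟩ := exists_gaussLaplace_expansion_aux h0 h1 (k + 2)
  refine ⟨C + risingCoeff β (k + 1) * gaussMoment (k + 1), fun s hs ↦ ?_⟩
  have h := hC s hs
  rw [Finset.sum_range_succ, ← sub_sub] at h
  simp only [mul_assoc] at h ⊢
  have hs0 : 0 < s := by linarith
  have h2 : 0 ≤ risingCoeff β (k + 1) * (gaussMoment (k + 1) * (s ^ (k + 2))⁻¹) :=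
    mul_nonneg (risingCoeff_nonneg h0 _) (mul_nonneg (gaussMoment_nonneg _) (by positivity))
  rw [add_mul, mul_assoc]
  rw [abs_le] at h ⊢
  constructor <;> linarith [h.1, h.2]

/-- Integrating an expansion in inverse powers at infinity produces a logarithm. -/
lemma exists_integral_expansion {P : ℝ → ℝ} (hP : Continuous P) (p : ℕ → ℝ) (k : ℕ) {C : ℝ}
    (hC : ∀ s : ℝ, 1 ≤ s →
      |P s - ∑ n ∈ Finset.range (k + 1), p n * (s ^ (n + 1))⁻¹| ≤ C * (s ^ (k + 2))⁻¹) :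
    ∃ Y D : ℝ, ∀ T : ℝ, 1 ≤ T →
      |(∫ s in (0 : ℝ)..T, P s)
          - (p 0 * Real.log T + Y - ∑ n ∈ Finset.Icc 1 k, p n / n * (T ^ n)⁻¹)|
        ≤ D * (T ^ (k + 1))⁻¹ := by
  set A : ℝ → ℝ := fun s ↦ p 0 * Real.log s - ∑ n ∈ Finset.Icc 1 k, p n / n * (s ^ n)⁻¹
  set S : ℝ → ℝ := fun s ↦ ∑ n ∈ Finset.range (k + 1), p n * (s ^ (n + 1))⁻¹ with hS
  have hScont : ContinuousOn S (Set.Ici 1) := by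
    refine continuousOn_finsetSum _ fun n _ ↦ continuousOn_const.mul
      ((continuousOn_id.pow _).inv₀ fun s hs ↦ ?_)
    exact pow_ne_zero _ (by simp only [Set.mem_Ici] at hs; simp; linarith)
  have hder (s : ℝ) (hs : 1 ≤ s) : HasDerivAt A (S s) s := by
    have hs0 : s ≠ 0 := by linarith
    have h1 : HasDerivAt (fun s : ℝ ↦ p 0 * Real.log s) (p 0 * s⁻¹) s :=
      (Real.hasDerivAt_log hs0).const_mul _
    have h2 : HasDerivAt (fun s : ℝ ↦ ∑ n ∈ Finset.Icc 1 k, p n / n * (s ^ n)⁻¹)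
        (∑ n ∈ Finset.Icc 1 k, -(p n * (s ^ (n + 1))⁻¹)) s := by
      refine HasDerivAt.fun_sum fun n hn ↦ ?_
      have hn1 : 1 ≤ n := (Finset.mem_Icc.mp hn).1
      obtain ⟨m, rfl⟩ : ∃ m, n = m + 1 := ⟨n - 1, by omega⟩
      have hm : ((m + 1 : ℕ) : ℝ) ≠ 0 := by positivity
      refine (((hasDerivAt_pow (m + 1) s).inv (pow_ne_zero _ hs0)).const_mul _).congr_deriv ?_
      rw [add_tsub_cancel_right]
      field_simp
      ring
    refine (h1.sub h2).congr_deriv ?_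
    simp only [hS]
    rw [Finset.sum_neg_distrib, sub_neg_eq_add, Finset.range_eq_Ico,
      Finset.sum_eq_sum_Ico_succ_bot (Nat.succ_pos k)]
    simp
    rfl
  have hrpow (s : ℝ) (hs : 1 ≤ s) : (s ^ (k + 2))⁻¹ = s ^ (-(k + 2) : ℝ) := by
    rw [Real.rpow_neg (by linarith), ← Real.rpow_natCast]
    push_cast
    rfl
  have hlt : (-(k + 2) : ℝ) < -1 := by linarith [Nat.cast_nonneg (α := ℝ) k]
  have hbound (T : ℝ) (hT : 1 ≤ T) : IntegrableOn (fun s : ℝ ↦ C * (s ^ (k + 2))⁻¹) (Set.Ioi T) := by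
    refine Integrable.const_mul ?_ _
    refine (integrableOn_Ioi_rpow_of_lt hlt (by linarith : 0 < T)).congr_fun
      (fun s (hs : T < s) ↦ (hrpow s (hT.trans hs.le)).symm) measurableSet_Ioi
  have hint : IntegrableOn (fun s ↦ P s - S s) (Set.Ioi 1) := by
    refine Integrable.mono' (hbound 1 le_rfl) ?_ ?_
    · exact ((hP.continuousOn.sub hScont).mono Set.Ioi_subset_Ici_self).aestronglyMeasurable
        measurableSet_Ioi
    · filter_upwards [ae_restrict_mem measurableSet_Ioi] with s (hs : 1 < s)
      exact hC s hs.le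
  refine ⟨(∫ s in (0 : ℝ)..1, P s) - A 1 + ∫ s in Set.Ioi 1, (P s - S s),
    C / (k + 1), fun T hT ↦ ?_⟩
  have hScont' : ContinuousOn S (Set.uIcc 1 T) := by
    rw [Set.uIcc_of_le hT]
    exact hScont.mono Set.Icc_subset_Ici_self
  have hSint : ∫ s in (1 : ℝ)..T, S s = A T - A 1 :=
    intervalIntegral.integral_eq_sub_of_hasDerivAt
      (fun s hs ↦ hder s (by rw [Set.uIcc_of_le hT] at hs; exact hs.1)) hScont'.intervalIntegrable
  have hPS : ∫ s in (1 : ℝ)..T, (P s - S s) = (∫ s in (1 : ℝ)..T, P s) - ∫ s in (1 : ℝ)..T, S s :=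
    intervalIntegral.integral_sub (hP.intervalIntegrable _ _) hScont'.intervalIntegrable
  have hP01 := intervalIntegral.integral_add_adjacent_intervals
    (hP.intervalIntegrable (μ := volume) 0 1) (hP.intervalIntegrable 1 T)
  have htail := intervalIntegral.integral_interval_add_Ioi hint
    (hint.mono_set (Set.Ioi_subset_Ioi hT))
  have hkey : (∫ s in (0 : ℝ)..T, P s) - (p 0 * Real.log T + ((∫ s in (0 : ℝ)..1, P s) - A 1
      + ∫ s in Set.Ioi 1, (P s - S s)) - ∑ n ∈ Finset.Icc 1 k, p n / n * (T ^ n)⁻¹)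
      = -∫ s in Set.Ioi T, (P s - S s) := by
    have hAT : A T = p 0 * Real.log T - ∑ n ∈ Finset.Icc 1 k, p n / n * (T ^ n)⁻¹ := rfl
    linarith
  rw [hkey, abs_neg, ← Real.norm_eq_abs]
  have hval : ∫ s in Set.Ioi T, C * (s ^ (k + 2))⁻¹ = C / (k + 1) * (T ^ (k + 1))⁻¹ := by
    rw [integral_const_mul, setIntegral_congr_fun measurableSet_Ioi
      (fun s (hs : T < s) ↦ hrpow s (hT.trans hs.le)),
      integral_Ioi_rpow_of_lt hlt (by linarith : 0 < T),
      show (-(k + 2) : ℝ) + 1 = -((k + 1 : ℕ) : ℝ) by push_cast; ring,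
      Real.rpow_neg (by linarith), Real.rpow_natCast]
    push_cast
    field_simp
  rw [← hval]
  refine norm_integral_le_of_norm_le (hbound T hT) ?_
  filter_upwards [ae_restrict_mem measurableSet_Ioi] with s (hs : T < s)
  exact hC s (hT.trans hs.le)

lemma integral_unitSquare_eq_add {F : ℝ → ℝ → ℝ}
    (hF : Integrable (Function.uncurry F)
      ((volume.restrict (Set.Ioc 0 1)).prod (volume.restrict (Set.Ioc 0 1)))) :
    ∫ x in (0 : ℝ)..1, ∫ y in (0 : ℝ)..1, F x y
      = (∫ x in (0 : ℝ)..1, ∫ y in (0 : ℝ)..x, F x y)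
        + ∫ y in (0 : ℝ)..1, ∫ x in (0 : ℝ)..y, F x y := by
  have hD : MeasurableSet {p : ℝ × ℝ | p.2 ≤ p.1} := measurableSet_le measurable_snd measurable_fst
  simp only [intervalIntegral.integral_of_le zero_le_one]
  rw [integral_integral hF]
  change ∫ z, Function.uncurry F z ∂_ = _
  rw [← integral_add_compl hD hF, ← integral_indicator hD,
    ← integral_indicator hD.compl, integral_prod _ (hF.indicator hD),
    integral_prod_symm _ (hF.indicator hD.compl)]
  congr 1
  · refine setIntegral_congr_fun measurableSet_Ioc fun x hx ↦ ?_
    simp only [intervalIntegral.integral_of_le hx.1.le]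
    calc _ = ∫ y in Set.Ioc (0 : ℝ) 1, (Set.Iic x).indicator (F x) y := rfl
      _ = _ := by
        rw [setIntegral_indicator measurableSet_Iic, Set.Ioc_inter_Iic, min_eq_right hx.2]
  · refine setIntegral_congr_fun measurableSet_Ioc fun y hy ↦ ?_
    simp only [intervalIntegral.integral_of_le hy.1.le]
    calc _ = ∫ x in Set.Ioc (0 : ℝ) 1, (Set.Iio y).indicator (fun x ↦ F x y) x := by
          refine setIntegral_congr_fun measurableSet_Ioc fun x _ ↦ ?_
          by_cases h : x < y <;> simp [Set.indicator, h, Function.uncurry]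
      _ = _ := by
        rw [setIntegral_indicator measurableSet_Iio, integral_Ioc_eq_integral_Ioo]
        congr 2
        ext x
        simp only [Set.mem_inter_iff, Set.mem_Ioc, Set.mem_Iio, Set.mem_Ioo]
        exact ⟨fun h ↦ ⟨h.1.1, h.2⟩, fun h ↦ ⟨⟨h.1, h.2.le.trans hy.2⟩, h.2⟩⟩

lemma integral_triangle_slice {x : ℝ} (hx : 0 < x) (c T : ℝ) :
    ∫ y in (0 : ℝ)..x, Real.exp (-(T * (x - y)) ^ 2) * (x ^ (-c) * y ^ (c - 1))
      = gaussLaplace (1 - c) (x * T) := by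
  have h := intervalIntegral.integral_comp_sub_mul (a := 0) (b := 1)
    (fun y ↦ Real.exp (-(T * (x - y)) ^ 2) * (x ^ (-c) * y ^ (c - 1))) hx.ne' x
  rw [mul_one, mul_zero, sub_self, sub_zero, smul_eq_mul, eq_inv_mul_iff_mul_eq₀ hx.ne'] at h
  rw [← h, intervalIntegral.integral_of_le zero_le_one, integral_Ioc_eq_integral_Ioo,
    ← integral_const_mul, gaussLaplace]
  refine setIntegral_congr_fun measurableSet_Ioo fun v hv ↦ ?_
  have h1 : x - x * v = x * (1 - v) := by ring
  have h2 : x * (x ^ (-c) * x ^ (c - 1)) = 1 := by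
    rw [← Real.rpow_add hx, show -c + (c - 1) = -1 by ring, Real.rpow_neg_one,
      mul_inv_cancel₀ hx.ne']
  rw [h1, Real.mul_rpow hx.le (by linarith [hv.2]), show -(1 - c) = c - 1 by ring,
    show T * (x - x * (1 - v)) = x * T * v by ring]
  linear_combination (Real.exp (-(x * T * v) ^ 2) * (1 - v) ^ (c - 1)) * h2

lemma integral_unitSquare_eq_gaussLaplace {a : ℝ} (ha0 : 0 < a) (ha1 : a < 1) {T : ℝ}
    (hT : 0 < T) :
    ∫ x in (0 : ℝ)..1, ∫ y in (0 : ℝ)..1,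
        Real.exp (-(T * (x - y)) ^ 2) * (x ^ (-a) * y ^ (-(1 - a)))
      = T⁻¹ * ∫ s in (0 : ℝ)..T, (gaussLaplace a s + gaussLaplace (1 - a) s) := by
  have hpow {r : ℝ} (hr : -1 < r) : Integrable (fun x : ℝ ↦ x ^ r) (volume.restrict (Set.Ioc 0 1)) := by
    have := intervalIntegral.intervalIntegrable_rpow' (a := 0) (b := 1) hr
    rwa [intervalIntegrable_iff_integrableOn_Ioc_of_le zero_le_one] at this
  rw [integral_unitSquare_eq_add]
  · have h1 : ∫ x in (0 : ℝ)..1, ∫ y in (0 : ℝ)..x,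
        Real.exp (-(T * (x - y)) ^ 2) * (x ^ (-a) * y ^ (-(1 - a)))
        = ∫ x in (0 : ℝ)..1, gaussLaplace (1 - a) (x * T) := by
      refine intervalIntegral.integral_congr_ae (Filter.Eventually.of_forall fun x hx ↦ ?_)
      rw [Set.uIoc_of_le zero_le_one] at hx
      rw [← integral_triangle_slice hx.1, neg_sub]
    have h2 : ∫ y in (0 : ℝ)..1, ∫ x in (0 : ℝ)..y,
        Real.exp (-(T * (x - y)) ^ 2) * (x ^ (-a) * y ^ (-(1 - a)))
        = ∫ x in (0 : ℝ)..1, gaussLaplace a (x * T) := by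
      refine intervalIntegral.integral_congr_ae (Filter.Eventually.of_forall fun y hy ↦ ?_)
      rw [Set.uIoc_of_le zero_le_one] at hy
      have := integral_triangle_slice hy.1 (1 - a) T
      rw [sub_sub_cancel] at this
      rw [← this]
      refine intervalIntegral.integral_congr fun x _ ↦ ?_
      rw [show (1 - a) - 1 = -a by ring, show (T * (x - y)) ^ 2 = (T * (y - x)) ^ 2 by ring]
      ring
    rw [h1, h2, intervalIntegral.integral_comp_mul_right _ hT.ne',
      intervalIntegral.integral_comp_mul_right _ hT.ne',
      intervalIntegral.integral_add
        ((continuous_gaussLaplace ha1).intervalIntegrable _ _)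
        ((continuous_gaussLaplace (by linarith)).intervalIntegrable _ _)]
    simp only [zero_mul, one_mul, smul_eq_mul]
    ring
  · have h := (hpow (r := -a) (by linarith)).mul_prod (hpow (r := -(1 - a)) (by linarith))
    refine h.bdd_mul (c := 1) (f := fun p : ℝ × ℝ ↦ Real.exp (-(T * (p.1 - p.2)) ^ 2))
      (by fun_prop) (Filter.Eventually.of_forall fun p ↦ ?_)
    rw [Real.norm_eq_abs, Real.abs_exp]
    exact Real.exp_le_one_iff.mpr (by nlinarith [sq_nonneg (T * (p.1 - p.2))])

lemma heatContentI_eq_ofReal {a : ℝ} (ha0 : 0 < a) (ha1 : a < 1) {t : ℝ} (ht : 0 < t) :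
    heatContentI (a : ℂ) ((1 - a : ℝ) : ℂ) t
      = (((√Real.pi)⁻¹ * ∫ s in (0 : ℝ)..(2 * √t)⁻¹,
          (gaussLaplace a s + gaussLaplace (1 - a) s) : ℝ) : ℂ) := by
  have hT : 0 < (2 * √t)⁻¹ := by positivity
  have hint : ∫ x in (0 : ℝ)..1, ∫ y in (0 : ℝ)..1,
      (↑(Real.exp (-(x - y) ^ 2 / (4 * t))) : ℂ) * (x : ℂ) ^ (-(a : ℂ))
        * (y : ℂ) ^ (-((1 - a : ℝ) : ℂ))
      = ((∫ x in (0 : ℝ)..1, ∫ y in (0 : ℝ)..1,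
        Real.exp (-((2 * √t)⁻¹ * (x - y)) ^ 2) * (x ^ (-a) * y ^ (-(1 - a))) : ℝ) : ℂ) := by
    rw [← intervalIntegral.integral_ofReal]
    refine intervalIntegral.integral_congr fun x hx ↦ ?_
    rw [← intervalIntegral.integral_ofReal]
    refine intervalIntegral.integral_congr fun y hy ↦ ?_
    rw [Set.uIcc_of_le zero_le_one] at hx hy
    have he : -((2 * √t)⁻¹ * (x - y)) ^ 2 = -(x - y) ^ 2 / (4 * t) := by
      rw [mul_pow, inv_pow, mul_pow, Real.sq_sqrt ht.le]
      field_simp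
      ring
    simp only [he]
    rw [← Complex.ofReal_neg, ← Complex.ofReal_neg, ← Complex.ofReal_cpow hx.1,
      ← Complex.ofReal_cpow hy.1]
    push_cast
    ring
  rw [heatContentI, hint, integral_unitSquare_eq_gaussLaplace ha0 ha1 hT, ← Complex.ofReal_inv,
    ← Complex.ofReal_mul]
  congr 1
  rw [mul_assoc, Real.sqrt_mul (by norm_num), Real.sqrt_mul Real.pi_pos.le,
    show √(4 : ℝ) = 2 by rw [show (4 : ℝ) = 2 ^ 2 by norm_num, Real.sqrt_sq (by norm_num)]]
  have : √t ≠ 0 := (Real.sqrt_pos.mpr ht).ne'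
  field_simp

lemma thetaAsc_ofReal (a : ℝ) (n : ℕ) :
    thetaAsc (a : ℂ) n = ((n.factorial * risingCoeff a n : ℝ) : ℂ) := by
  have : ((n.factorial : ℕ) : ℝ) ≠ 0 := by positivity
  rw [risingCoeff, mul_div_cancel₀ _ this, thetaAsc]
  push_cast
  rfl

lemma cnCoeff_eq_ofReal (a : ℝ) {n : ℕ} (hn : 1 ≤ n) :
    cnCoeff (a : ℂ) ((1 - a : ℝ) : ℂ) n
      = ((-((√Real.pi)⁻¹ * ((risingCoeff a n + risingCoeff (1 - a) n) * gaussMoment n / n)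
          * 2 ^ n) : ℝ) : ℂ) := by
  have hg : Complex.Gamma ((1 + (n : ℂ)) / 2) = ((Real.Gamma ((n + 1) / 2) : ℝ) : ℂ) := by
    rw [← Complex.Gamma_ofReal]
    push_cast
    ring_nf
  have hn0 : (n : ℂ) ≠ 0 := by exact_mod_cast (by omega : n ≠ 0)
  have hf : (n.factorial : ℂ) ≠ 0 := by exact_mod_cast n.factorial_ne_zero
  have hpi : ((√Real.pi : ℝ) : ℂ) ≠ 0 := by
    exact_mod_cast (Real.sqrt_pos.mpr Real.pi_pos).ne'
  rw [cnCoeff, hg, thetaAsc_ofReal, thetaAsc_ofReal, gaussMoment, zpow_sub₀ two_ne_zero,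
    zpow_natCast, zpow_one, show 1 - (a : ℂ) - ((1 - a : ℝ) : ℂ) - n = -n by push_cast; ring]
  push_cast
  field_simp

lemma inv_pow_inv_two_mul_sqrt {t : ℝ} (ht : 0 < t) (n : ℕ) :
    (((2 * √t)⁻¹) ^ n)⁻¹ = 2 ^ n * t ^ ((n : ℝ) / 2) := by
  rw [inv_pow, inv_inv, mul_pow, Real.sqrt_eq_rpow, ← Real.rpow_natCast (t ^ _),
    ← Real.rpow_mul ht.le]
  ring_nf

/-- Lemma 3.13: the expansion of `h_{a,1-a}(t)` with a logarithmic leading term when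
`a ∈ (0,1)`. -/
theorem heatContentI_log_expansion_ab_eq_one
    (a : ℝ) (ha0 : 0 < a) (ha1 : a < 1) (k : ℕ) (hk : 2 ≤ k) :
    ∃ Y : ℝ, ∃ C > 0, ∃ t₀ > 0, ∀ t : ℝ, 0 < t → t < t₀ →
      ‖heatContentI (a : ℂ) ((1 - a : ℝ) : ℂ) t
          - (-(1/2) * (↑(Real.log t) : ℂ) + (Y : ℂ)
            + ∑ n ∈ Finset.Icc 1 k,
                cnCoeff (a : ℂ) ((1 - a : ℝ) : ℂ) n * (t : ℂ) ^ ((n : ℂ) / 2))‖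
        ≤ C * t ^ ((k + 1 : ℝ) / 2) := by
  have hb0 : 0 < 1 - a := by linarith
  have hb1 : 1 - a < 1 := by linarith
  obtain ⟨C₁, h₁⟩ := exists_gaussLaplace_expansion ha0 ha1 k
  obtain ⟨C₂, h₂⟩ := exists_gaussLaplace_expansion hb0 hb1 k
  set p : ℕ → ℝ := fun n ↦ (risingCoeff a n + risingCoeff (1 - a) n) * gaussMoment n with hp
  obtain ⟨Y, D, hD⟩ := exists_integral_expansion
    ((continuous_gaussLaplace ha1).add (continuous_gaussLaplace hb1)) p k (C := C₁ + C₂)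
    (fun s hs ↦ by
      have hsum : ∑ n ∈ Finset.range (k + 1), p n * (s ^ (n + 1))⁻¹
          = (∑ n ∈ Finset.range (k + 1), risingCoeff a n * gaussMoment n * (s ^ (n + 1))⁻¹)
            + ∑ n ∈ Finset.range (k + 1),
                risingCoeff (1 - a) n * gaussMoment n * (s ^ (n + 1))⁻¹ := by
        simp only [hp, add_mul, Finset.sum_add_distrib]
      rw [hsum, Pi.add_apply, add_sub_add_comm, add_mul]
      exact (abs_add_le _ _).trans (add_le_add (h₁ s hs) (h₂ s hs)))
  have hπ : 0 < √Real.pi := Real.sqrt_pos.mpr Real.pi_pos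
  have hp0 : p 0 = √Real.pi := by
    simp only [hp, risingCoeff, gaussMoment]
    norm_num [Real.Gamma_one_half_eq]
    ring
  refine ⟨(√Real.pi)⁻¹ * Y - Real.log 2, (√Real.pi)⁻¹ * |D| * 2 ^ (k + 1) + 1, by positivity,
    1 / 4, by norm_num, fun t ht ht4 ↦ ?_⟩
  have hst : 0 < √t := Real.sqrt_pos.mpr ht
  have hst2 : √t < 1 / 2 := by
    rw [Real.sqrt_lt' (by norm_num)]
    linarith
  have hT : 1 ≤ (2 * √t)⁻¹ := (one_le_inv₀ (by positivity)).mpr (by linarith)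
  have hlog : Real.log (2 * √t)⁻¹ = -Real.log 2 - (1 / 2) * Real.log t := by
    rw [Real.log_inv, Real.log_mul two_ne_zero hst.ne', Real.log_sqrt ht.le]
    ring
  have hsum : ∑ n ∈ Finset.Icc 1 k,
      cnCoeff (a : ℂ) ((1 - a : ℝ) : ℂ) n * (t : ℂ) ^ ((n : ℂ) / 2)
      = ((-((√Real.pi)⁻¹ * ∑ n ∈ Finset.Icc 1 k, p n / n * (((2 * √t)⁻¹) ^ n)⁻¹) : ℝ) : ℂ) := by
    rw [Finset.mul_sum, ← Finset.sum_neg_distrib, Complex.ofReal_sum]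
    refine Finset.sum_congr rfl fun n hn ↦ ?_
    rw [cnCoeff_eq_ofReal a (Finset.mem_Icc.mp hn).1, inv_pow_inv_two_mul_sqrt ht,
      show (n : ℂ) / 2 = (((n : ℝ) / 2 : ℝ) : ℂ) by push_cast; rfl, ← Complex.ofReal_cpow ht.le,
      ← Complex.ofReal_mul]
    congr 1
    ring
  have hmain := hD _ hT
  rw [hlog, hp0, inv_pow_inv_two_mul_sqrt ht] at hmain
  rw [heatContentI_eq_ofReal ha0 ha1 ht, hsum]
  have hreal : ∀ I S : ℝ, ((((√Real.pi)⁻¹ * I : ℝ) : ℂ) - (-(1/2) * (↑(Real.log t) : ℂ)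
      + (((√Real.pi)⁻¹ * Y - Real.log 2 : ℝ) : ℂ) + ((-((√Real.pi)⁻¹ * S) : ℝ) : ℂ)))
      = (((√Real.pi)⁻¹ * (I - (√Real.pi * (-Real.log 2 - (1 / 2) * Real.log t) + Y - S)) : ℝ) : ℂ) := by
    intro I S
    have h : (√Real.pi)⁻¹ * (I - (√Real.pi * (-Real.log 2 - (1 / 2) * Real.log t) + Y - S))
        = (√Real.pi)⁻¹ * I - (-(1/2) * Real.log t + ((√Real.pi)⁻¹ * Y - Real.log 2)
          + -((√Real.pi)⁻¹ * S)) := by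
      field_simp
      ring
    rw [h]
    push_cast
    ring
  rw [hreal, Complex.norm_real, Real.norm_eq_abs, abs_mul, abs_of_pos (inv_pos.mpr hπ)]
  have htk : 0 < t ^ ((k + 1 : ℝ) / 2) := Real.rpow_pos_of_pos ht _
  push_cast at hmain
  calc _ ≤ (√Real.pi)⁻¹ * (D * (2 ^ (k + 1) * t ^ ((k + 1 : ℝ) / 2))) := by gcongr; exact hmain
    _ ≤ (√Real.pi)⁻¹ * (|D| * (2 ^ (k + 1) * t ^ ((k + 1 : ℝ) / 2))) := by
      gcongr
      exact le_abs_self D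
    _ ≤ _ := by linarith
end

section
/- Let a, b be complex numbers with Re(a) < 1, Re(b) < 1 and 1 < Re(a+b) < 2, and let t > 0. Then the integral (4πt)^{-1/2} ∫₀^∞∫₀^∞ e^{-(x-y)²/(4t)} x^{-a} y^{-b} dx dy converges absolutely and equals c(a,b) t^{(1-a-b)/2}. -/
open MeasureTheory

/-- The coefficient `c(a,b)` of `t^{(1-a-b)/2}` in the heat content expansion. -/
noncomputable def cCoeff (a b : ℂ) : ℂ :=
  (2 : ℂ) ^ (-a - b) * (↑(Real.sqrt Real.pi) : ℂ)⁻¹ *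
    Complex.Gamma ((2 - a - b) / 2) * Complex.Gamma (a + b - 1) *
    (Complex.Gamma (1 - a) / Complex.Gamma b + Complex.Gamma (1 - b) / Complex.Gamma a)

open Set

lemma setIntegral_gaussian_cpow {s : ℂ} (hs : 0 < s.re) {t : ℝ} (ht : 0 < t) :
    IntegrableOn (fun r : ℝ => (r : ℂ) ^ (s - 1) * (Real.exp (-r ^ 2 / (4 * t)) : ℂ)) (Ioi 0) ∧
    ∫ r in Ioi (0 : ℝ), (r : ℂ) ^ (s - 1) * (Real.exp (-r ^ 2 / (4 * t)) : ℂ) =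
      (2 : ℂ)⁻¹ * ((4 * t : ℝ) : ℂ) ^ (s / 2) * Complex.Gamma (s / 2) := by
  have hc : (0 : ℝ) < (4 * t)⁻¹ := by positivity
  have hs2 : 0 < (s / 2).re := by simpa using hs
  have hfun (r : ℝ) : (Real.exp (-r ^ 2 / (4 * t)) : ℂ) =
      (fun y : ℝ => (Real.exp (-((4 * t)⁻¹ * y)) : ℂ)) (r ^ (2 : ℝ)) := by
    simp only [Real.rpow_two]
    congr 2
    ring
  have hconv : MellinConvergent (fun y : ℝ => (Real.exp (-y) : ℂ)) (s / 2) := by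
    simpa [MellinConvergent, mul_comm] using Complex.GammaIntegral_convergent hs2
  have hval : mellin (fun y : ℝ => (Real.exp (-y) : ℂ)) (s / 2) = Complex.Gamma (s / 2) := by
    rw [Complex.Gamma_eq_integral hs2, Complex.GammaIntegral_eq_mellin]
  simp_rw [hfun]
  constructor
  · have h1 := (MellinConvergent.comp_mul_left (f := fun y : ℝ => (Real.exp (-y) : ℂ))
      (s := s / 2) hc).2 hconv
    have h2 := (MellinConvergent.comp_rpow (s := s) (a := 2)
      (f := fun y : ℝ => (Real.exp (-((4 * t)⁻¹ * y)) : ℂ)) two_ne_zero).2 (by simpa using h1)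
    simpa [MellinConvergent] using h2
  · have h1 := mellin_comp_mul_left (fun y : ℝ => (Real.exp (-y) : ℂ)) (s / 2) hc
    have h2 := mellin_comp_rpow (fun y : ℝ => (Real.exp (-((4 * t)⁻¹ * y)) : ℂ)) s 2
    simp only [Complex.ofReal_ofNat] at h2
    rw [h1, hval] at h2
    rw [mellin] at h2
    simp only [smul_eq_mul] at h2
    rw [h2, Complex.ofReal_inv, Complex.inv_cpow, Complex.cpow_neg, inv_inv]
    · simp [Complex.real_smul, mul_assoc]
    · rw [Complex.arg_ofReal_of_nonneg (by positivity)]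
      exact Real.pi_pos.ne

lemma setIntegral_beta_cpow {u v : ℂ} (hu : 0 < u.re) (hv : 0 < v.re) :
    IntegrableOn (fun x : ℝ => (x : ℂ) ^ (u - 1) * (1 - (x : ℂ)) ^ (v - 1)) (Ioo 0 1) ∧
    ∫ x in Ioo (0 : ℝ) 1, (x : ℂ) ^ (u - 1) * (1 - (x : ℂ)) ^ (v - 1) =
      Complex.Gamma u * Complex.Gamma v / Complex.Gamma (u + v) := by
  constructor
  · have h := Complex.betaIntegral_convergent hu hv
    rw [intervalIntegrable_iff_integrableOn_Ioo_of_le zero_le_one] at h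
    exact h
  · rw [Complex.Gamma_mul_Gamma_eq_betaIntegral hu hv, mul_div_cancel_left₀,
      Complex.betaIntegral, intervalIntegral.integral_of_le zero_le_one,
      integral_Ioc_eq_integral_Ioo]
    exact Complex.Gamma_ne_zero_of_re_pos (by simpa using add_pos hu hv)

/-- The map `(r, u) ↦ (r / u, r / u - r)`, which parametrizes the wedge `0 < y < x` by
`r = x - y > 0` and `u = (x - y) / x ∈ (0, 1)`. -/
noncomputable abbrev wedgeMap (q : ℝ × ℝ) : ℝ × ℝ := (q.1 * q.2⁻¹, q.1 * q.2⁻¹ - q.1)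

/-- The derivative of `wedgeMap`. -/
noncomputable def wedgeDeriv (p : ℝ × ℝ) : ℝ × ℝ →L[ℝ] ℝ × ℝ :=
  (Matrix.toLin (.finTwoProd ℝ) (.finTwoProd ℝ)
    !![p.2⁻¹, -p.1 / p.2 ^ 2; p.2⁻¹ - 1, -p.1 / p.2 ^ 2]).toContinuousLinearMap

lemma hasFDerivAt_wedgeMap {p : ℝ × ℝ} (hp : p.2 ≠ 0) :
    HasFDerivAt wedgeMap (wedgeDeriv p) p := by
  have h := (hasFDerivAt_fst (𝕜 := ℝ) (p := p)).mul
    ((hasDerivAt_inv hp).comp_hasFDerivAt p hasFDerivAt_snd)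
  unfold wedgeDeriv
  rw [Matrix.toLin_finTwoProd_toContinuousLinearMap]
  convert! h.prodMk (h.sub hasFDerivAt_fst) using 1
  ext <;> simp <;> ring

lemma det_wedgeDeriv (p : ℝ × ℝ) : (wedgeDeriv p).det = -(p.1 / p.2 ^ 2) := by
  rw [wedgeDeriv]
  simp only [LinearMap.det_toContinuousLinearMap, LinearMap.det_toLin, Matrix.det_fin_two_of]
  ring

lemma image_wedgeMap :
    wedgeMap '' (Ioi 0 ×ˢ Ioo 0 1) =
      {p : ℝ × ℝ | 0 < p.2 ∧ p.2 < p.1} := by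
  ext ⟨x, y⟩
  constructor
  · rintro ⟨⟨r, u⟩, ⟨hr, hu0, hu1⟩, h⟩
    simp only [mem_Ioi, Prod.mk.injEq] at hr hu0 hu1 h
    obtain ⟨rfl, rfl⟩ := h
    have : 1 < u⁻¹ := (one_lt_inv₀ hu0).2 hu1
    constructor <;> dsimp only <;> nlinarith
  · rintro ⟨hy, hyx⟩
    dsimp only at hy hyx
    have hx : 0 < x := hy.trans hyx
    have hxy : x - y ≠ 0 := (sub_pos.2 hyx).ne'
    refine ⟨(x - y, (x - y) / x), ⟨sub_pos.2 hyx, div_pos (sub_pos.2 hyx) hx, ?_⟩, ?_⟩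
    · rw [div_lt_one hx]; linarith
    · ext <;> simp <;> field_simp; ring

lemma injOn_wedgeMap :
    InjOn wedgeMap (Ioi 0 ×ˢ Ioo 0 1) := by
  rintro ⟨r, u⟩ ⟨hr, -⟩ ⟨r', u'⟩ - h
  simp only [mem_Ioi, Prod.mk.injEq] at hr h
  obtain ⟨h1, h2⟩ := h
  obtain rfl : r = r' := by linarith
  simpa using mul_left_cancel₀ hr.ne' h1

/-- The part `0 < y < x` of the heat content integral. -/
lemma setIntegral_wedge {a b : ℂ} (hb : b.re < 1) (hab1 : 1 < (a + b).re)
    (hab2 : (a + b).re < 2) {t : ℝ} (ht : 0 < t) :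
    IntegrableOn (fun p : ℝ × ℝ => (↑(Real.exp (-(p.1 - p.2) ^ 2 / (4 * t))) : ℂ)
          * (p.1 : ℂ) ^ (-a) * (p.2 : ℂ) ^ (-b)) {p : ℝ × ℝ | 0 < p.2 ∧ p.2 < p.1} ∧
    ∫ p in {p : ℝ × ℝ | 0 < p.2 ∧ p.2 < p.1}, (↑(Real.exp (-(p.1 - p.2) ^ 2 / (4 * t))) : ℂ)
          * (p.1 : ℂ) ^ (-a) * (p.2 : ℂ) ^ (-b) =
      (2 : ℂ)⁻¹ * ((4 * t : ℝ) : ℂ) ^ ((2 - a - b) / 2) * Complex.Gamma ((2 - a - b) / 2) *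
        (Complex.Gamma (a + b - 1) * Complex.Gamma (1 - b) / Complex.Gamma a) := by
  have hmeas : MeasurableSet (Ioi (0 : ℝ) ×ˢ Ioo (0 : ℝ) 1) :=
    measurableSet_Ioi.prod measurableSet_Ioo
  obtain ⟨hG, hGv⟩ := setIntegral_gaussian_cpow (s := 2 - a - b)
    (by simp at hab2 ⊢; linarith) ht
  obtain ⟨hB, hBv⟩ := setIntegral_beta_cpow (u := a + b - 1) (v := 1 - b)
    (by simp at hab1 ⊢; linarith) (by simpa using hb)
  have hpull : EqOn (fun q : ℝ × ℝ => |(wedgeDeriv q).det| •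
        ((↑(Real.exp (-(q.1 * q.2⁻¹ - (q.1 * q.2⁻¹ - q.1)) ^ 2 / (4 * t))) : ℂ)
          * ((q.1 * q.2⁻¹ : ℝ) : ℂ) ^ (-a) * ((q.1 * q.2⁻¹ - q.1 : ℝ) : ℂ) ^ (-b)))
      (fun q : ℝ × ℝ =>
        ((q.1 : ℂ) ^ (2 - a - b - 1) * (Real.exp (-q.1 ^ 2 / (4 * t)) : ℂ)) *
        ((q.2 : ℂ) ^ (a + b - 1 - 1) * (1 - (q.2 : ℂ)) ^ (1 - b - 1)))
      (Ioi 0 ×ˢ Ioo 0 1) := by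
    rintro ⟨r, u⟩ ⟨hr, hu0, hu1⟩
    simp only [mem_Ioi] at hr hu0 hu1
    have hr' : (r : ℂ) ≠ 0 := by exact_mod_cast hr.ne'
    have hu' : (u : ℂ) ≠ 0 := by exact_mod_cast hu0.ne'
    have hy : r * u⁻¹ - r = r * (u⁻¹ * (1 - u)) := by field_simp
    have hinv (z : ℂ) : ((u⁻¹ : ℝ) : ℂ) ^ z = (u : ℂ) ^ (-z) := by
      rw [Complex.ofReal_inv, Complex.inv_cpow, Complex.cpow_neg]
      rw [Complex.arg_ofReal_of_nonneg hu0.le]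
      exact Real.pi_pos.ne
    have e1 : (2 : ℂ) - a - b - 1 = 1 + -a + -b := by ring
    have e2 : a + b - 1 - 1 = a + b - 2 := by ring
    have e3 : 1 - b - 1 = -b := by ring
    simp only [det_wedgeDeriv, abs_neg, sub_sub_cancel]
    rw [hy, abs_of_pos (by positivity), Complex.real_smul, Complex.ofReal_mul r u⁻¹,
      Complex.ofReal_mul r, Complex.ofReal_mul u⁻¹,
      Complex.mul_cpow_ofReal_nonneg hr.le (by positivity), ← Complex.ofReal_mul u⁻¹,
      Complex.mul_cpow_ofReal_nonneg hr.le (mul_nonneg (by positivity) (sub_nonneg.2 hu1.le)),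
      Complex.ofReal_mul u⁻¹,
      Complex.mul_cpow_ofReal_nonneg (by positivity) (sub_nonneg.2 hu1.le), hinv, hinv,
      e1, e2, e3, Complex.cpow_add _ _ hr', Complex.cpow_add _ _ hr', Complex.cpow_sub _ _ hu',
      Complex.cpow_add _ _ hu']
    simp
    ring
  have hderiv : ∀ q ∈ Ioi (0 : ℝ) ×ˢ Ioo (0 : ℝ) 1, HasFDerivWithinAt wedgeMap (wedgeDeriv q)
      (Ioi (0 : ℝ) ×ˢ Ioo (0 : ℝ) 1) q :=
    fun q hq => (hasFDerivAt_wedgeMap hq.2.1.ne').hasFDerivWithinAt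
  rw [← image_wedgeMap]
  constructor
  · rw [integrableOn_image_iff_integrableOn_abs_det_fderiv_smul _ hmeas hderiv injOn_wedgeMap,
      integrableOn_congr_fun hpull hmeas, IntegrableOn, Measure.volume_eq_prod,
      ← Measure.prod_restrict]
    exact Integrable.mul_prod hG hB
  · rw [integral_image_eq_integral_abs_det_fderiv_smul _ hmeas hderiv injOn_wedgeMap,
      setIntegral_congr_fun hmeas hpull, Measure.volume_eq_prod, ← Measure.prod_restrict,
      integral_prod_mul (fun r : ℝ => (r : ℂ) ^ (2 - a - b - 1) *
        (Real.exp (-r ^ 2 / (4 * t)) : ℂ))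
        (fun u : ℝ => (u : ℂ) ^ (a + b - 1 - 1) * (1 - (u : ℂ)) ^ (1 - b - 1)), hGv, hBv]
    congr 3
    ring

lemma volume_diagonal_real : volume {p : ℝ × ℝ | p.1 = p.2} = 0 := by
  rw [Measure.volume_eq_prod, Measure.measure_prod_null
    (measurableSet_eq_fun measurable_fst measurable_snd)]
  refine Filter.Eventually.of_forall fun x => ?_
  simp [preimage, Set.ofPred_eq_eq_singleton']

/-- Lemma 3.9 for `k = -1`: the heat content of the half line with `φ(x) = x^{-a}`,
`ρ(y) = y^{-b}` converges absolutely when `1 < Re(a+b) < 2` and equals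
`c(a,b) t^{(1-a-b)/2}`. -/
theorem heatContent_halfLine_eq
    (a b : ℂ) (ha : a.re < 1) (hb : b.re < 1)
    (hab1 : 1 < (a + b).re) (hab2 : (a + b).re < 2) (t : ℝ) (ht : 0 < t) :
    IntegrableOn
      (fun p : ℝ × ℝ =>
        (↑(Real.exp (-(p.1 - p.2) ^ 2 / (4 * t))) : ℂ)
          * (p.1 : ℂ) ^ (-a) * (p.2 : ℂ) ^ (-b))
      (Set.Ioi 0 ×ˢ Set.Ioi 0) volume ∧
    (↑(Real.sqrt (4 * Real.pi * t)) : ℂ)⁻¹ *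
        ∫ p in Set.Ioi (0:ℝ) ×ˢ Set.Ioi (0:ℝ),
          (↑(Real.exp (-(p.1 - p.2) ^ 2 / (4 * t))) : ℂ)
            * (p.1 : ℂ) ^ (-a) * (p.2 : ℂ) ^ (-b)
      = cCoeff a b * (t : ℂ) ^ ((1 - a - b) / 2) := by
  set F : ℝ × ℝ → ℂ := fun p => (↑(Real.exp (-(p.1 - p.2) ^ 2 / (4 * t))) : ℂ)
          * (p.1 : ℂ) ^ (-a) * (p.2 : ℂ) ^ (-b) with hF
  set G : ℝ × ℝ → ℂ := fun p => (↑(Real.exp (-(p.1 - p.2) ^ 2 / (4 * t))) : ℂ)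
          * (p.1 : ℂ) ^ (-b) * (p.2 : ℂ) ^ (-a) with hG
  set W : Set (ℝ × ℝ) := {p | 0 < p.2 ∧ p.2 < p.1}
  obtain ⟨hI, hIv⟩ := setIntegral_wedge hb hab1 hab2 ht
  obtain ⟨hJ, hJv⟩ := setIntegral_wedge ha (a := b) (by rwa [add_comm]) (by rwa [add_comm]) ht
  have hswap : MeasurePreserving (Prod.swap : ℝ × ℝ → ℝ × ℝ) := Measure.measurePreserving_swap
  have hemb : MeasurableEmbedding (Prod.swap : ℝ × ℝ → ℝ × ℝ) :=
    MeasurableEquiv.prodComm.measurableEmbedding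
  have hFswap : G ∘ Prod.swap = F := by
    ext p
    simp only [hF, hG, Function.comp_apply, Prod.fst_swap, Prod.snd_swap,
      ← neg_sub p.1 p.2, neg_sq]
    ring
  have hJ' : IntegrableOn F (Prod.swap ⁻¹' W) := by
    rw [← hFswap]
    exact (hswap.integrableOn_comp_preimage hemb).2 hJ
  have hFint : ∫ p in Prod.swap ⁻¹' W, F p = ∫ p in W, G p := by
    rw [← hFswap]
    exact hswap.setIntegral_preimage_emb hemb G W
  have hWm : MeasurableSet W := (measurableSet_lt measurable_const measurable_snd).inter
    (measurableSet_lt measurable_snd measurable_fst)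
  have hdisj : Disjoint W (Prod.swap ⁻¹' W) := by
    rw [Set.disjoint_left]
    rintro p ⟨-, h1⟩ ⟨-, h2⟩
    exact lt_asymm h1 h2
  have hae : (Ioi (0 : ℝ) ×ˢ Ioi (0 : ℝ) : Set (ℝ × ℝ)) =ᵐ[volume]
      (W ∪ Prod.swap ⁻¹' W : Set (ℝ × ℝ)) := by
    have hd : ∀ᵐ p : ℝ × ℝ, p.1 ≠ p.2 := by
      rw [ae_iff]; simpa using volume_diagonal_real
    filter_upwards [hd] with p hp
    refine propext ⟨fun ⟨h1, h2⟩ => ?_, ?_⟩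
    · rcases lt_or_gt_of_ne hp with h | h
      · exact Or.inr ⟨h1, h⟩
      · exact Or.inl ⟨h2, h⟩
    · rintro (⟨h1, h2⟩ | ⟨h1, h2⟩)
      · exact ⟨h1.trans h2, h1⟩
      · exact ⟨h1, lt_trans h1 h2⟩
  refine ⟨(integrableOn_congr_set_ae hae).2 (hI.union hJ'), ?_⟩
  rw [setIntegral_congr_set hae, setIntegral_union hdisj (hemb.measurable hWm) hI hJ', hIv, hFint,
    hJv, cCoeff]
  have ht' : (t : ℂ) ≠ 0 := by exact_mod_cast ht.ne'
  have hsq : Real.sqrt (4 * Real.pi * t) = 2 * Real.sqrt Real.pi * Real.sqrt t := by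
    rw [Real.sqrt_mul (by positivity), Real.sqrt_mul (by positivity)]
    congr 2
    rw [show (4 : ℝ) = 2 ^ 2 by norm_num, Real.sqrt_sq (by norm_num)]
  have hpow : ((4 * t : ℝ) : ℂ) ^ ((2 - a - b) / 2) =
      4 * (2 : ℂ) ^ (-a - b) * ((Real.sqrt t : ℂ) * (t : ℂ) ^ ((1 - a - b) / 2)) := by
    rw [Complex.ofReal_mul, Complex.mul_cpow_ofReal_nonneg (by norm_num) ht.le]
    congr 1
    · rw [show (2 - a - b) / 2 = 1 + (-a - b) / 2 by ring, Complex.cpow_add _ _ (by norm_num),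
        show (4 : ℝ) = 2 * 2 by norm_num, Complex.ofReal_mul,
        Complex.mul_cpow_ofReal_nonneg zero_le_two zero_le_two, Complex.cpow_one,
        Complex.mul_cpow_ofReal_nonneg zero_le_two zero_le_two, ← Complex.cpow_add _ _ (by norm_num),
        add_halves]
      norm_num
    · rw [Real.sqrt_eq_rpow, Complex.ofReal_cpow ht.le, ← Complex.cpow_add _ _ ht']
      congr 1
      push_cast
      ring
  have hst : (Real.sqrt t : ℂ) ≠ 0 := by exact_mod_cast (Real.sqrt_pos.2 ht).ne'
  have hsp : (Real.sqrt Real.pi : ℂ) ≠ 0 := by exact_mod_cast (Real.sqrt_pos.2 Real.pi_pos).ne'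
  rw [sub_right_comm 2 b a, add_comm b a, hpow, hsq]
  push_cast
  field_simp
  ring
end

section
/- Let a, b be complex numbers with Re(a) < 1 and Re(b) < 1. Then ∫₀^∞∫₀^∞ e^{-(x+y)²} x^{-a} y^{-b} dx dy = (1/2) Γ((2−a−b)/2) Γ(1−a) Γ(1−b) / Γ(2−a−b). -/
open MeasureTheory

/-- The change of variables `u = x + y` in a quadrant integral against `x ^ (s - 1) * y ^ (t - 1)`
splits off a Beta integral. -/
theorem setIntegral_quadrant_add_mul_cpow {g : ℝ → ℂ} {s t : ℂ}
    (hg : IntegrableOn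
      (fun p : ℝ × ℝ => g (p.1 + p.2) * (p.1 : ℂ) ^ (s - 1) * (p.2 : ℂ) ^ (t - 1))
      (Set.Ioi 0 ×ˢ Set.Ioi 0)) :
    ∫ p in Set.Ioi (0 : ℝ) ×ˢ Set.Ioi (0 : ℝ),
        g (p.1 + p.2) * (p.1 : ℂ) ^ (s - 1) * (p.2 : ℂ) ^ (t - 1)
      = mellin g (s + t) * Complex.betaIntegral s t := by
  have hQ : MeasurableSet (Set.Ioi (0 : ℝ) ×ˢ Set.Ioi (0 : ℝ)) :=
    measurableSet_Ioi.prod measurableSet_Ioi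
  have hmp : MeasurePreserving (fun z : ℝ × ℝ => (z.2, z.1 - z.2)) volume volume :=
    measurePreserving_prod_sub_swap volume volume
  have hemb : MeasurableEmbedding (fun z : ℝ × ℝ => (z.2, z.1 - z.2)) :=
    (MeasurableEquiv.prodComm.trans (MeasurableEquiv.shearSubRight ℝ)).measurableEmbedding
  rw [← integrable_indicator_iff hQ, ← hmp.integrable_comp_emb hemb] at hg
  rw [← integral_indicator hQ, ← hmp.integral_comp hemb, Measure.volume_eq_prod]
  rw [Measure.volume_eq_prod] at hg
  refine (integral_prod _ hg).trans ?_
  rw [mellin, ← integral_mul_const, ← integral_indicator measurableSet_Ioi]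
  refine integral_congr_ae (Filter.Eventually.of_forall fun u => ?_)
  have hslice : (fun x : ℝ => (Set.Ioi (0 : ℝ) ×ˢ Set.Ioi (0 : ℝ)).indicator
      (fun p : ℝ × ℝ => g (p.1 + p.2) * (p.1 : ℂ) ^ (s - 1) * (p.2 : ℂ) ^ (t - 1)) (x, u - x))
      = (Set.Ioo 0 u).indicator
        (fun x : ℝ => g u * ((x : ℂ) ^ (s - 1) * ((u : ℂ) - x) ^ (t - 1))) := by
    ext x
    simp [Set.indicator_apply, mul_assoc]
  simp only [Function.comp_apply, hslice]
  rw [integral_indicator measurableSet_Ioo, integral_const_mul]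
  by_cases hu : 0 < u
  · rw [Set.indicator_of_mem (Set.mem_Ioi.2 hu), ← integral_Ioc_eq_integral_Ioo,
      ← intervalIntegral.integral_of_le hu.le, Complex.betaIntegral_scaled s t hu, smul_eq_mul]
    ring
  · rw [Set.indicator_of_notMem (by simpa using hu), Set.Ioo_eq_empty hu]
    simp

theorem mellinConvergent_exp_neg_sq {s : ℂ} (hs : 0 < s.re) :
    MellinConvergent (fun x : ℝ => (Real.exp (-x ^ 2) : ℂ)) s := by
  have h : MellinConvergent (fun x : ℝ => (Real.exp (-x) : ℂ)) (s / (2 : ℝ)) := by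
    have hs' : 0 < (s / (2 : ℝ)).re := by
      rw [Complex.div_ofReal_re]
      positivity
    simpa only [MellinConvergent, smul_eq_mul, mul_comm] using Complex.GammaIntegral_convergent hs'
  simpa only [Real.rpow_two] using (MellinConvergent.comp_rpow two_ne_zero).2 h

theorem mellin_exp_neg_sq {s : ℂ} (hs : 0 < s.re) :
    mellin (fun x : ℝ => (Real.exp (-x ^ 2) : ℂ)) s = 1 / 2 * Complex.Gamma (s / 2) := by
  have hs' : 0 < (s / 2).re := by
    rw [Complex.div_ofNat_re]
    positivity
  have h := mellin_comp_rpow (fun x : ℝ => (Real.exp (-x) : ℂ)) s 2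
  simp only [Real.rpow_two] at h
  rw [h, Complex.Gamma_eq_integral hs', Complex.GammaIntegral_eq_mellin]
  simp

theorem integrableOn_quadrant_exp_neg_sq_mul_cpow {s t : ℂ} (hs : 0 < s.re) (ht : 0 < t.re) :
    IntegrableOn
      (fun p : ℝ × ℝ =>
        (Real.exp (-(p.1 + p.2) ^ 2) : ℂ) * (p.1 : ℂ) ^ (s - 1) * (p.2 : ℂ) ^ (t - 1))
      (Set.Ioi 0 ×ˢ Set.Ioi 0) := by
  have hprod := Integrable.mul_prod (mellinConvergent_exp_neg_sq hs)
    (mellinConvergent_exp_neg_sq ht)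
  rw [Measure.prod_restrict, ← Measure.volume_eq_prod] at hprod
  have hcont : Continuous fun p : ℝ × ℝ => (Real.exp (-(2 * p.1 * p.2)) : ℂ) := by fun_prop
  refine (hprod.bdd_mul (c := 1) hcont.aestronglyMeasurable ?_).congr ?_
  · filter_upwards [ae_restrict_mem (measurableSet_Ioi.prod measurableSet_Ioi)] with p hp
    have h1 : 0 < p.1 := hp.1
    have h2 : 0 < p.2 := hp.2
    rw [Complex.norm_real, Real.norm_of_nonneg (Real.exp_nonneg _), Real.exp_le_one_iff,
      neg_nonpos]
    positivity
  · refine Filter.Eventually.of_forall fun p => ?_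
    have hexp : Real.exp (-(p.1 + p.2) ^ 2)
        = Real.exp (-(2 * p.1 * p.2)) * Real.exp (-p.1 ^ 2) * Real.exp (-p.2 ^ 2) := by
      rw [← Real.exp_add, ← Real.exp_add]
      ring_nf
    simp only [hexp, smul_eq_mul, Complex.ofReal_mul]
    ring

/-- `∫₀^∞∫₀^∞ e^{-(x+y)²} x^{-a} y^{-b} dx dy
  = (1/2) Γ((2-a-b)/2) Γ(1-a) Γ(1-b) / Γ(2-a-b)`. -/
theorem integral_quadrant_exp_neg_sq_cpow
    (a b : ℂ) (ha : a.re < 1) (hb : b.re < 1) :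
    ∫ p in Set.Ioi (0:ℝ) ×ˢ Set.Ioi (0:ℝ),
        (↑(Real.exp (-(p.1 + p.2) ^ 2)) : ℂ) * (p.1 : ℂ) ^ (-a) * (p.2 : ℂ) ^ (-b)
      = (1/2) * Complex.Gamma ((2 - a - b) / 2) * Complex.Gamma (1 - a)
          * Complex.Gamma (1 - b) / Complex.Gamma (2 - a - b) := by
  have hs : 0 < (1 - a).re := by simpa using ha
  have ht : 0 < (1 - b).re := by simpa using hb
  have hst : 0 < (1 - a + (1 - b)).re := by
    rw [Complex.add_re]
    positivity
  have key := setIntegral_quadrant_add_mul_cpow (g := fun x : ℝ => (Real.exp (-x ^ 2) : ℂ))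
    (integrableOn_quadrant_exp_neg_sq_mul_cpow hs ht)
  rw [mellin_exp_neg_sq hst] at key
  simp only [sub_sub_cancel_left] at key
  rw [key, show 2 - a - b = 1 - a + (1 - b) by ring,
    eq_div_iff (Complex.Gamma_ne_zero_of_re_pos hst), mul_assoc _ (Complex.Gamma (1 - a)),
    Complex.Gamma_mul_Gamma_eq_betaIntegral hs ht]
  ring
end

section
/- Let a, b be complex numbers with Re(a) < 1 and Re(b) < 1. There exist constants C > 0 and t₀ > 0 such that for all 0 < t < t₀: | (4πt)^{-1/2} ∫₀¹∫₀¹ e^{-(x+y)²/(4t)} x^{-a} y^{-b} dx dy − t^{(1-a-b)/2} · 2^{-a-b} π^{-1/2} Γ((2−a−b)/2) Γ(1−a) Γ(1−b) / Γ(2−a−b) | ≤ C e^{-1/(8t)}. -/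
open MeasureTheory

open Set in
/-- Beta-type reduction of a quadrant integral of a function of `x + y` against powers. -/
theorem setIntegral_quadrant_comp_add_mul_cpow (g : ℝ → ℂ) (u v : ℂ)
    (hint : IntegrableOn (fun p : ℝ × ℝ => g (p.1 + p.2) * (p.1 : ℂ) ^ (u - 1) *
      (p.2 : ℂ) ^ (v - 1)) (Ioi 0 ×ˢ Ioi 0)) :
    ∫ p in (Ioi (0 : ℝ) ×ˢ Ioi (0 : ℝ)), g (p.1 + p.2) * (p.1 : ℂ) ^ (u - 1) *
        (p.2 : ℂ) ^ (v - 1) =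
      Complex.betaIntegral u v * ∫ s in Ioi (0 : ℝ), (s : ℂ) ^ (u + v - 1) * g s := by
  have hQ : MeasurableSet (Ioi (0 : ℝ) ×ˢ Ioi (0 : ℝ)) := measurableSet_Ioi.prod measurableSet_Ioi
  set G : ℝ × ℝ → ℂ := fun q => (Ioi (0 : ℝ)).indicator (fun s => (Ioo 0 s).indicator
    (fun x : ℝ => g s * ((x : ℂ) ^ (u - 1) * ((s : ℂ) - x) ^ (v - 1))) q.1) q.2 with hG
  have hcomp : (Ioi (0 : ℝ) ×ˢ Ioi (0 : ℝ)).indicator (fun p : ℝ × ℝ => g (p.1 + p.2) *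
      (p.1 : ℂ) ^ (u - 1) * (p.2 : ℂ) ^ (v - 1)) =
      G ∘ (MeasurableEquiv.shearAddRight ℝ) := by
    ext ⟨x, y⟩
    have hsh : (MeasurableEquiv.shearAddRight ℝ) (x, y) = (x, x + y) := rfl
    simp only [Function.comp_apply, hsh, hG, indicator_apply, mem_prod, mem_Ioi, mem_Ioo,
      lt_add_iff_pos_right]
    by_cases hx : 0 < x <;> by_cases hy : 0 < y
    · simp [hx, hy, add_pos hx hy, mul_assoc]
    all_goals simp [hx, hy]
  have hmp : MeasurePreserving (MeasurableEquiv.shearAddRight ℝ) (volume.prod volume)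
      ((volume : Measure ℝ).prod volume) := measurePreserving_prod_add volume volume
  rw [← integrable_indicator_iff hQ, hcomp, Measure.volume_eq_prod,
    hmp.integrable_comp_emb (MeasurableEquiv.measurableEmbedding _)] at hint
  rw [← integral_indicator hQ, hcomp, Measure.volume_eq_prod]
  simp only [Function.comp_apply]
  rw [hmp.integral_comp (MeasurableEquiv.measurableEmbedding _), integral_prod_symm _ hint,
    ← integral_const_mul, ← integral_indicator measurableSet_Ioi]
  refine integral_congr_ae (ae_of_all _ fun s => ?_)
  by_cases hs : 0 < s
  · simp only [hG, indicator_of_mem (mem_Ioi.2 hs)]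
    rw [integral_indicator measurableSet_Ioo, integral_const_mul, ← integral_Ioc_eq_integral_Ioo,
      ← intervalIntegral.integral_of_le hs.le, Complex.betaIntegral_scaled u v hs]
    ring
  · simp [hG, hs]

open Set in
theorem integral_cpow_mul_exp_neg_mul_sq {w : ℂ} (hw : 0 < w.re) {r : ℝ} (hr : 0 < r) :
    ∫ s in Ioi (0 : ℝ), (s : ℂ) ^ (w - 1) * (Real.exp (-(r * s ^ 2)) : ℂ) =
      (1 / 2) * ((1 / r : ℂ) ^ (w / 2) * Complex.Gamma (w / 2)) := by
  have h := mellin_comp_rpow (fun s : ℝ => (Real.exp (-(r * s)) : ℂ)) w 2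
  have hw2 : 0 < (w / 2).re := by
    rw [Complex.div_ofNat_re]; positivity
  have h' := Complex.integral_cpow_mul_exp_neg_mul_Ioi hw2 hr
  simp only [mellin, smul_eq_mul, Real.rpow_two] at h
  rw [h, ← h']
  simp

/-- The Gaussian kernel is exponentially small away from the corner of the quadrant. -/
theorem exp_neg_add_sq_div_le {t x y : ℝ} (ht : 0 < t) (ht1 : t < 1) (hx : 0 < x) (hy : 0 < y)
    (hxy : 1 < x + y) :
    Real.exp (-(x + y) ^ 2 / (4 * t)) ≤ Real.exp (-1 / (8 * t)) * Real.exp (-1 / (16 * t)) *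
      (Real.exp (-(1 / 16) * x ^ 2) * Real.exp (-(1 / 16) * y ^ 2)) := by
  simp only [← Real.exp_add]
  gcongr
  have h1 : 1 ≤ (x + y) ^ 2 := by nlinarith
  have h2 : x ^ 2 + y ^ 2 ≤ (x + y) ^ 2 := by nlinarith [mul_pos hx hy]
  have h3 : -1 / (8 * t) + -1 / (16 * t) + (-(1 / 16) * x ^ 2 + -(1 / 16) * y ^ 2)
      = (-3 - t * (x ^ 2 + y ^ 2)) / (16 * t) := by field_simp; ring
  rw [h3, div_le_div_iff₀ (by positivity) (by positivity)]
  have h4 : t * (x ^ 2 + y ^ 2) ≤ (x + y) ^ 2 := by nlinarith [sq_nonneg x, sq_nonneg y]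
  nlinarith

theorem inv_sqrt_four_pi_mul_le {t : ℝ} (ht : 0 < t) :
    (Real.sqrt (4 * Real.pi * t))⁻¹ ≤ Real.exp (1 / (16 * t)) := by
  have hpi := Real.pi_gt_three
  rw [← Real.sqrt_inv, Real.sqrt_le_left (Real.exp_pos _).le, ← Real.exp_nat_mul]
  calc (4 * Real.pi * t)⁻¹ ≤ (8 * t)⁻¹ := by gcongr; linarith
    _ ≤ (8 * t)⁻¹ + 1 := by linarith
    _ ≤ Real.exp ((8 * t)⁻¹) := Real.add_one_le_exp _
    _ = _ := by congr 1; push_cast; field_simp; norm_num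

open Set in
theorem integrableOn_quadrant_rpow_mul_gaussian {c p q : ℝ} (hc : 0 < c) (hp : -1 < p)
    (hq : -1 < q) :
    IntegrableOn (fun z : ℝ × ℝ => (z.1 ^ p * Real.exp (-c * z.1 ^ 2)) *
      (z.2 ^ q * Real.exp (-c * z.2 ^ 2))) (Ioi 0 ×ˢ Ioi 0) := by
  rw [IntegrableOn, Measure.volume_eq_prod, ← Measure.prod_restrict]
  exact (integrableOn_rpow_mul_exp_neg_mul_sq hc hp).mul_prod
    (integrableOn_rpow_mul_exp_neg_mul_sq hc hq)

theorem norm_ofReal_exp_mul_cpow_mul_cpow (a b : ℂ) (r : ℝ) {x y : ℝ} (hx : 0 < x) (hy : 0 < y) :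
    ‖(Real.exp r : ℂ) * (x : ℂ) ^ (-a) * (y : ℂ) ^ (-b)‖ =
      Real.exp r * x ^ (-a.re) * y ^ (-b.re) := by
  rw [norm_mul, norm_mul, Complex.norm_cpow_eq_rpow_re_of_pos hx,
    Complex.norm_cpow_eq_rpow_re_of_pos hy, Complex.norm_real,
    Real.norm_of_nonneg (Real.exp_pos _).le, Complex.neg_re, Complex.neg_re]

open Set in
theorem integrableOn_quadrant_exp_neg_add_sq_mul_cpow {a b : ℂ} (ha : a.re < 1) (hb : b.re < 1)
    {t : ℝ} (ht : 0 < t) :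
    IntegrableOn (fun p : ℝ × ℝ => (Real.exp (-(p.1 + p.2) ^ 2 / (4 * t)) : ℂ) *
      (p.1 : ℂ) ^ (-a) * (p.2 : ℂ) ^ (-b)) (Ioi 0 ×ˢ Ioi 0) := by
  refine Integrable.mono' (integrableOn_quadrant_rpow_mul_gaussian (c := 1 / (4 * t))
    (p := -a.re) (q := -b.re) (by positivity) (by linarith) (by linarith)) ?_ ?_
  · exact Measurable.aestronglyMeasurable (by fun_prop)
  · filter_upwards [ae_restrict_mem (measurableSet_Ioi.prod measurableSet_Ioi)] with p hp
    obtain ⟨hx, hy⟩ := mem_prod.1 hp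
    rw [mem_Ioi] at hx hy
    rw [norm_ofReal_exp_mul_cpow_mul_cpow a b _ hx hy]
    have hexp : Real.exp (-(p.1 + p.2) ^ 2 / (4 * t)) ≤
        Real.exp (-(1 / (4 * t)) * p.1 ^ 2) * Real.exp (-(1 / (4 * t)) * p.2 ^ 2) := by
      rw [← Real.exp_add]
      gcongr
      have : -(1 / (4 * t)) * p.1 ^ 2 + -(1 / (4 * t)) * p.2 ^ 2 =
        -(p.1 ^ 2 + p.2 ^ 2) / (4 * t) := by ring
      rw [this]
      gcongr
      nlinarith [mul_pos hx hy]
    calc _ = Real.exp (-(p.1 + p.2) ^ 2 / (4 * t)) * (p.1 ^ (-a.re) * p.2 ^ (-b.re)) := by ring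
      _ ≤ (Real.exp (-(1 / (4 * t)) * p.1 ^ 2) * Real.exp (-(1 / (4 * t)) * p.2 ^ 2)) *
          (p.1 ^ (-a.re) * p.2 ^ (-b.re)) := by gcongr
      _ = _ := by ring

open Set in
theorem setIntegral_quadrant_exp_neg_add_sq_mul_cpow {a b : ℂ} (ha : a.re < 1) (hb : b.re < 1)
    {t : ℝ} (ht : 0 < t) :
    (↑(Real.sqrt (4 * Real.pi * t)) : ℂ)⁻¹ * ∫ p in (Ioi (0 : ℝ) ×ˢ Ioi (0 : ℝ)),
      (Real.exp (-(p.1 + p.2) ^ 2 / (4 * t)) : ℂ) * (p.1 : ℂ) ^ (-a) * (p.2 : ℂ) ^ (-b) =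
    (t : ℂ) ^ ((1 - a - b) / 2) * (2 : ℂ) ^ (-a - b)
      * (↑(Real.sqrt Real.pi) : ℂ)⁻¹ * Complex.Gamma ((2 - a - b) / 2)
      * Complex.Gamma (1 - a) * Complex.Gamma (1 - b) / Complex.Gamma (2 - a - b) := by
  have hu : 0 < (1 - a).re := by simpa using ha
  have hv : 0 < (1 - b).re := by simpa using hb
  have huv : (1 - a) + (1 - b) = 2 - a - b := by ring
  have hw : 0 < (2 - a - b).re := by rw [← huv, Complex.add_re]; positivity
  have hint := integrableOn_quadrant_exp_neg_add_sq_mul_cpow ha hb ht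
  have hbeta := Complex.Gamma_mul_Gamma_eq_betaIntegral hu hv
  have hred := setIntegral_quadrant_comp_add_mul_cpow
    (fun s => (Real.exp (-s ^ 2 / (4 * t)) : ℂ)) (1 - a) (1 - b)
  rw [huv] at hbeta hred
  simp only [sub_sub_cancel_left] at hred
  have hgauss := integral_cpow_mul_exp_neg_mul_sq hw (r := 1 / (4 * t)) (by positivity)
  have hr : ∀ s : ℝ, -(1 / (4 * t) * s ^ 2) = -s ^ 2 / (4 * t) := fun s => by ring
  simp only [hr] at hgauss
  have ht0 : (t : ℂ) ≠ 0 := by exact_mod_cast ht.ne'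
  have hpow : (1 / ((1 / (4 * t) : ℝ) : ℂ)) ^ ((2 - a - b) / 2) =
      4 * (2 : ℂ) ^ (-a - b) * ((Real.sqrt t : ℂ) * (t : ℂ) ^ ((1 - a - b) / 2)) := by
    have h4 : (1 / ((1 / (4 * t) : ℝ) : ℂ)) = ((2 * 2 : ℝ) : ℂ) * (t : ℂ) := by
      push_cast; rw [one_div_one_div]; norm_num
    have hst : (Real.sqrt t : ℂ) = (t : ℂ) ^ (1 / 2 : ℂ) := by
      rw [Real.sqrt_eq_rpow, Complex.ofReal_cpow ht.le]; norm_num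
    have h2 : ((2 * 2 : ℝ) : ℂ) ^ ((2 - a - b) / 2) = 4 * (2 : ℂ) ^ (-a - b) := by
      rw [Complex.ofReal_mul, Complex.mul_cpow_ofReal_nonneg zero_le_two zero_le_two,
        Complex.ofReal_ofNat, ← Complex.cpow_add _ _ two_ne_zero,
        show (2 - a - b) / 2 + (2 - a - b) / 2 = 2 + (-a - b) by ring,
        Complex.cpow_add _ _ two_ne_zero]
      norm_num
    rw [h4, Complex.mul_cpow_ofReal_nonneg (by norm_num) ht.le, h2, hst,
      ← Complex.cpow_add _ _ ht0]
    congr 2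
    ring
  have hsqrt : (Real.sqrt (4 * Real.pi * t) : ℂ) = 2 * Real.sqrt Real.pi * Real.sqrt t := by
    rw [mul_assoc, Real.sqrt_mul (by norm_num), Real.sqrt_mul Real.pi_pos.le,
      show (4 : ℝ) = 2 ^ 2 by norm_num, Real.sqrt_sq zero_le_two]
    push_cast
    ring
  have hsπ : (Real.sqrt Real.pi : ℂ) ≠ 0 := by
    exact_mod_cast (Real.sqrt_pos.2 Real.pi_pos).ne'
  have hst0 : (Real.sqrt t : ℂ) ≠ 0 := by exact_mod_cast (Real.sqrt_pos.2 ht).ne'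
  have hΓ := Complex.Gamma_ne_zero_of_re_pos hw
  rw [hred hint, hgauss, hpow, hsqrt, mul_assoc _ (Complex.Gamma (1 - a)), hbeta]
  field_simp
  ring

theorem correction_term_expansion (a b : ℂ) (ha : a.re < 1) (hb : b.re < 1) :
    ∃ C > 0, ∃ t₀ > 0, ∀ t : ℝ, 0 < t → t < t₀ →
      ‖(↑(Real.sqrt (4 * Real.pi * t)) : ℂ)⁻¹ *
          (∫ x in (0:ℝ)..1, ∫ y in (0:ℝ)..1,
            (↑(Real.exp (-(x + y) ^ 2 / (4 * t))) : ℂ) * (x : ℂ) ^ (-a) * (y : ℂ) ^ (-b))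
        - (t : ℂ) ^ ((1 - a - b) / 2) * (2 : ℂ) ^ (-a - b)
            * (↑(Real.sqrt Real.pi) : ℂ)⁻¹ * Complex.Gamma ((2 - a - b) / 2)
            * Complex.Gamma (1 - a) * Complex.Gamma (1 - b)
            / Complex.Gamma (2 - a - b)‖
      ≤ C * Real.exp (-1 / (8 * t)) := by
  have hD := integrableOn_quadrant_rpow_mul_gaussian (c := 1 / 16)
    (p := -a.re) (q := -b.re) (by norm_num) (by linarith) (by linarith)
  set Q : Set (ℝ × ℝ) := Set.Ioi (0 : ℝ) ×ˢ Set.Ioi (0 : ℝ) with hQdef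
  set S : Set (ℝ × ℝ) := Set.Ioc (0 : ℝ) 1 ×ˢ Set.Ioc (0 : ℝ) 1 with hSdef
  set M : ℝ × ℝ → ℝ := fun z => (z.1 ^ (-a.re) * Real.exp (-(1 / 16) * z.1 ^ 2)) *
      (z.2 ^ (-b.re) * Real.exp (-(1 / 16) * z.2 ^ 2)) with hM
  have hQ : MeasurableSet Q := measurableSet_Ioi.prod measurableSet_Ioi
  have hS : MeasurableSet S := measurableSet_Ioc.prod measurableSet_Ioc
  have hSQ : S ⊆ Q := Set.prod_mono Set.Ioc_subset_Ioi_self Set.Ioc_subset_Ioi_self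
  have hM0 : ∀ z ∈ Q, 0 ≤ M z := fun z hz => by
    have hx : 0 < z.1 := hz.1
    have hy : 0 < z.2 := hz.2
    positivity
  have hD0 : 0 ≤ ∫ z in Q, M z := setIntegral_nonneg hQ hM0
  refine ⟨(∫ z in Q, M z) + 1, by positivity, 1, one_pos, fun t ht ht1 => ?_⟩
  have hint := integrableOn_quadrant_exp_neg_add_sq_mul_cpow ha hb ht
  rw [← setIntegral_quadrant_exp_neg_add_sq_mul_cpow ha hb ht]
  set F : ℝ × ℝ → ℂ := fun p => (Real.exp (-(p.1 + p.2) ^ 2 / (4 * t)) : ℂ) *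
      (p.1 : ℂ) ^ (-a) * (p.2 : ℂ) ^ (-b) with hF
  have hsquare : (∫ x in (0:ℝ)..1, ∫ y in (0:ℝ)..1,
      (↑(Real.exp (-(x + y) ^ 2 / (4 * t))) : ℂ) * (x : ℂ) ^ (-a) * (y : ℂ) ^ (-b)) =
      ∫ p in S, F p := by
    have hFS := hint.mono_set hSQ
    rw [Measure.volume_eq_prod] at hFS ⊢
    rw [setIntegral_prod _ hFS]
    simp only [intervalIntegral.integral_of_le zero_le_one, hF]
  have htail : ‖∫ p in Q \ S, F p‖ ≤
      Real.exp (-1 / (8 * t)) * Real.exp (-1 / (16 * t)) * ∫ z in Q, M z := by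
    rw [← integral_const_mul]
    refine (norm_integral_le_of_norm_le ((hD.mono_set Set.sdiff_subset).const_mul
      (Real.exp (-1 / (8 * t)) * Real.exp (-1 / (16 * t)))) ?_).trans
      (setIntegral_mono_set (hD.const_mul _) ?_ Set.sdiff_subset.eventuallyLE)
    · filter_upwards [ae_restrict_mem (hQ.diff hS)] with p hp
      have hx : 0 < p.1 := hp.1.1
      have hy : 0 < p.2 := hp.1.2
      have hxy : 1 < p.1 + p.2 := by
        by_contra! h
        exact hp.2 ⟨⟨hx, by linarith⟩, ⟨hy, by linarith⟩⟩
      rw [hF, norm_ofReal_exp_mul_cpow_mul_cpow a b _ hx hy]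
      calc _ = Real.exp (-(p.1 + p.2) ^ 2 / (4 * t)) * (p.1 ^ (-a.re) * p.2 ^ (-b.re)) := by ring
        _ ≤ (Real.exp (-1 / (8 * t)) * Real.exp (-1 / (16 * t)) *
              (Real.exp (-(1 / 16) * p.1 ^ 2) * Real.exp (-(1 / 16) * p.2 ^ 2))) *
            (p.1 ^ (-a.re) * p.2 ^ (-b.re)) := by
          gcongr
          exact exp_neg_add_sq_div_le ht ht1 hx hy hxy
        _ = _ := by ring
    · filter_upwards [ae_restrict_mem hQ] with p hp
      have := hM0 p hp
      simp only [Pi.zero_apply]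
      positivity
  have hpre : ‖(↑(Real.sqrt (4 * Real.pi * t)) : ℂ)⁻¹‖ ≤ Real.exp (1 / (16 * t)) := by
    rw [norm_inv, Complex.norm_real, Real.norm_of_nonneg (Real.sqrt_nonneg _)]
    exact inv_sqrt_four_pi_mul_le ht
  have hcancel : Real.exp (1 / (16 * t)) * Real.exp (-1 / (16 * t)) = 1 := by
    rw [← Real.exp_add, ← add_div]; simp
  rw [hsquare, ← mul_sub, norm_mul, norm_sub_rev, ← setIntegral_sdiff hS hint hSQ]
  calc _ ≤ Real.exp (1 / (16 * t)) *
        (Real.exp (-1 / (8 * t)) * Real.exp (-1 / (16 * t)) * ∫ z in Q, M z) := by gcongr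
    _ = (Real.exp (1 / (16 * t)) * Real.exp (-1 / (16 * t))) *
        ((∫ z in Q, M z) * Real.exp (-1 / (8 * t))) := by ring
    _ ≤ _ := by
      rw [hcancel, one_mul]
      gcongr
      linarith
end

section
/- Let φ ∈ L¹((0,∞)) and t > 0. Then (1) ∫₀^∞ |Tφ(x;t)| dx ≤ ‖φ‖_{L¹}, and (2) for every δ > 0, ∫₀^∞ |T(χ_{[δ,∞)}φ)(x;t)| dx ≤ 2 e^{-δ²/(8t)} ‖φ‖_{L¹}, where χ_{[δ,∞)} denotes the indicator function of [δ,∞). -/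
open MeasureTheory

/-- `Tφ(x;t) = (4πt)^{-1/2} ∫₀^∞ e^{-(x+y)²/(4t)} φ(y) dy`. -/
noncomputable def Theat (φ : ℝ → ℝ) (x t : ℝ) : ℝ :=
  (Real.sqrt (4 * Real.pi * t))⁻¹ *
    ∫ y in Set.Ioi (0:ℝ), Real.exp (-(x + y) ^ 2 / (4 * t)) * φ y

/-- Gaussian decay of `Theat ψ` for a function `ψ` vanishing on `(0, δ)`. -/
lemma abs_Theat_le {ψ : ℝ → ℝ} (hψ : IntegrableOn ψ (Set.Ioi 0)) {t : ℝ} (ht : 0 < t)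
    {δ : ℝ} (hδ : 0 ≤ δ) (hzero : ∀ y, 0 < y → y < δ → ψ y = 0) {x : ℝ} (hx : 0 ≤ x) :
    |Theat ψ x t| ≤ (Real.sqrt (4 * Real.pi * t))⁻¹ * (Real.exp (-δ ^ 2 / (4 * t)) *
      ∫ y in Set.Ioi (0:ℝ), |ψ y|) * Real.exp (-(1 / (4 * t)) * x ^ 2) := by
  have hc : 0 ≤ (Real.sqrt (4 * Real.pi * t))⁻¹ := by positivity
  rw [Theat, abs_mul, abs_of_nonneg hc, mul_assoc (Real.sqrt _)⁻¹]
  refine mul_le_mul_of_nonneg_left ?_ hc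
  rw [mul_right_comm, ← integral_const_mul, ← Real.norm_eq_abs]
  refine norm_integral_le_of_norm_le (hψ.abs.const_mul _) ?_
  filter_upwards [ae_restrict_mem measurableSet_Ioi] with y hy
  have hy0 : 0 < y := hy
  rcases lt_or_ge y δ with h | h
  · simp [hzero y hy0 h]
  · rw [norm_mul, Real.norm_eq_abs, Real.norm_eq_abs, Real.abs_exp, ← Real.exp_add]
    refine mul_le_mul_of_nonneg_right (Real.exp_le_exp.2 ?_) (abs_nonneg _)
    have hsum : -δ ^ 2 / (4 * t) + -(1 / (4 * t)) * x ^ 2 = -(δ ^ 2 + x ^ 2) / (4 * t) := by ring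
    rw [hsum]
    gcongr
    nlinarith [mul_nonneg hx hy0.le]

/-- The `L¹` bound for `Theat ψ` for a function `ψ` vanishing on `(0, δ)`. -/
lemma integral_abs_Theat_le {ψ : ℝ → ℝ} (hψ : IntegrableOn ψ (Set.Ioi 0)) {t : ℝ} (ht : 0 < t)
    {δ : ℝ} (hδ : 0 ≤ δ) (hzero : ∀ y, 0 < y → y < δ → ψ y = 0) :
    ∫ x in Set.Ioi (0:ℝ), |Theat ψ x t| ≤
      Real.exp (-δ ^ 2 / (4 * t)) / 2 * ∫ y in Set.Ioi (0:ℝ), |ψ y| := by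
  have hb : 0 < 1 / (4 * t) := by positivity
  have hs : Real.sqrt (4 * Real.pi * t) ≠ 0 := by positivity
  calc ∫ x in Set.Ioi (0:ℝ), |Theat ψ x t|
      ≤ ∫ x in Set.Ioi (0:ℝ), (Real.sqrt (4 * Real.pi * t))⁻¹ * (Real.exp (-δ ^ 2 / (4 * t)) *
          ∫ y in Set.Ioi (0:ℝ), |ψ y|) * Real.exp (-(1 / (4 * t)) * x ^ 2) := by
        refine integral_mono_of_nonneg (.of_forall fun _ => abs_nonneg _)
          ((integrable_exp_neg_mul_sq hb).integrableOn.const_mul _) ?_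
        filter_upwards [ae_restrict_mem measurableSet_Ioi] with x hx
        exact abs_Theat_le hψ ht hδ hzero (le_of_lt hx)
    _ = Real.exp (-δ ^ 2 / (4 * t)) / 2 * ∫ y in Set.Ioi (0:ℝ), |ψ y| := by
        rw [integral_const_mul, integral_gaussian_Ioi,
          show Real.pi / (1 / (4 * t)) = 4 * Real.pi * t by field_simp]
        field_simp

/-- Lemma 5.2 (1),(2): `‖Tφ(⋅;t)‖_{L¹} ≤ ‖φ‖_{L¹}`, and
`‖T(χ_{[δ,∞)}φ)(⋅;t)‖_{L¹} ≤ 2 e^{-δ²/(8t)} ‖φ‖_{L¹}` for every `δ > 0`. -/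
theorem Theat_L1_bounds (φ : ℝ → ℝ) (hφ : IntegrableOn φ (Set.Ioi 0))
    (t : ℝ) (ht : 0 < t) :
    (∫ x in Set.Ioi (0:ℝ), |Theat φ x t|) ≤ (∫ y in Set.Ioi (0:ℝ), |φ y|) ∧
    ∀ δ : ℝ, 0 < δ →
      (∫ x in Set.Ioi (0:ℝ), |Theat (Set.indicator (Set.Ici δ) φ) x t|)
        ≤ 2 * Real.exp (-δ ^ 2 / (8 * t)) * ∫ y in Set.Ioi (0:ℝ), |φ y| := by
  have hN : 0 ≤ ∫ y in Set.Ioi (0:ℝ), |φ y| := integral_nonneg fun _ => abs_nonneg _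
  refine ⟨?_, fun δ hδ => ?_⟩
  · have h := integral_abs_Theat_le hφ ht le_rfl fun y h₁ h₂ => absurd h₁ h₂.not_gt
    simp only [ne_eq, OfNat.ofNat_ne_zero, not_false_eq_true, zero_pow, neg_zero, zero_div,
      Real.exp_zero] at h
    linarith
  · have h := integral_abs_Theat_le (hφ.indicator (measurableSet_Ici (a := δ))) ht hδ.le
      fun y _ hy => Set.indicator_of_notMem (not_le.2 hy) φ
    refine h.trans (mul_le_mul ?_ ?_ (integral_nonneg fun _ => abs_nonneg _) (by positivity))
    · have hexp : Real.exp (-δ ^ 2 / (4 * t)) ≤ Real.exp (-δ ^ 2 / (8 * t)) := by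
        rw [Real.exp_le_exp, neg_div, neg_div, neg_le_neg_iff]
        gcongr
        norm_num
      linarith [Real.exp_pos (-δ ^ 2 / (8 * t))]
    · refine integral_mono_of_nonneg (.of_forall fun _ => abs_nonneg _) hφ.abs
        (.of_forall fun y => ?_)
      simpa only [Real.norm_eq_abs] using norm_indicator_le_norm_self φ y
end
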